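/- arXiv:2602.04282 — 2 statements merged into one kernel-verified Lean document; each statement's English description precedes it below -/
import Mathlib

section
/- Theorem 2.3, continuous-time part (quenched CLT for the continuous-time step-reinforced Lévy–Lorentz gas): for every 0 ≤ p < 3/4, as t → ∞, X̃^{(p)}_t/√t converges in distribution to a centered Gaussian random variable with variance ℓ(3 − 4p)^{−1}. -/
open MeasureTheory ProbabilityTheory Filter Set Topology

/-- A nonnegative sequence which is contracted by `1 - δ / (n + 1)` at step `n`, up to an error
`o(1 / n)`, tends to zero. -/
lemma tendsto_zero_of_le_one_sub_div_mul_add {y e : ℕ → ℝ} {δ : ℝ} (hδ : 0 < δ)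
    (hy : ∀ n, 0 ≤ y n) (he : Tendsto e atTop (𝓝 0))
    (h : ∀ᶠ n : ℕ in atTop, y (n + 1) ≤ (1 - δ / (n + 1)) * y n + e n / (n + 1)) :
    Tendsto y atTop (𝓝 0) := by
  have harm : Tendsto (fun n : ℕ => δ * ∑ i ∈ Finset.range n, (1 / ((i : ℝ) + 1))) atTop atTop :=
    Real.tendsto_sum_range_one_div_nat_succ_atTop.const_mul_atTop hδ
  rw [Metric.tendsto_atTop]
  intro η hη
  have h1 : ∀ᶠ n : ℕ in atTop, e n < δ * (η / 2) := he.eventually_lt_const (by positivity)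
  obtain ⟨n₀, hn₀⟩ := eventually_atTop.1 (h.and (h1.and (eventually_ge_atTop ⌈δ⌉₊)))
  set P : ℕ → ℝ := fun n => Real.exp (-(δ * ∑ i ∈ Finset.range n, (1 / ((i : ℝ) + 1)))) with hP
  have hPpos : ∀ n, 0 < P n := fun n => Real.exp_pos _
  have key : ∀ n, n₀ ≤ n → y n - η / 2 ≤ (y n₀ / P n₀) * P n := by
    intro n hn
    induction n, hn using Nat.le_induction with
    | base => rw [div_mul_cancel₀ _ (hPpos _).ne']; linarith
    | succ n hn ih =>
      obtain ⟨ha, hb, hc⟩ := hn₀ n hn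
      have hn1 : (0 : ℝ) < n + 1 := by positivity
      have hstep : P (n + 1) = P n * Real.exp (-(δ / (n + 1))) := by
        simp only [hP, Finset.sum_range_succ, ← Real.exp_add]
        congr 1; ring
      have hexp : 1 - δ / (n + 1) ≤ Real.exp (-(δ / (n + 1))) := by
        have := Real.add_one_le_exp (-(δ / ((n : ℝ) + 1))); linarith
      have hK : 0 ≤ y n₀ / P n₀ := div_nonneg (hy _) (hPpos _).le
      have hee : e n / (n + 1) ≤ δ / (n + 1) * (η / 2) := by
        rw [div_mul_eq_mul_div]; gcongr
      have h2 : y (n + 1) - η / 2 ≤ (1 - δ / (n + 1)) * (y n - η / 2) := by nlinarith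
      rw [hstep]
      have hc : 0 ≤ 1 - δ / ((n : ℝ) + 1) := by
        rw [sub_nonneg, div_le_one hn1]
        have : (⌈δ⌉₊ : ℝ) ≤ n := by exact_mod_cast hc
        linarith [Nat.le_ceil δ]
      calc _ ≤ _ := h2
        _ ≤ (1 - δ / (n + 1)) * (y n₀ / P n₀ * P n) := by gcongr
        _ ≤ Real.exp (-(δ / (n + 1))) * (y n₀ / P n₀ * P n) := by
            have := hPpos n
            gcongr
        _ = _ := by ring
  have hlim : Tendsto (fun n => (y n₀ / P n₀) * P n) atTop (𝓝 0) := by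
    have : Tendsto P atTop (𝓝 0) := Real.tendsto_exp_neg_atTop_nhds_zero.comp harm
    simpa using this.const_mul (y n₀ / P n₀)
  obtain ⟨N, hN⟩ := eventually_atTop.1
    ((hlim.eventually_lt_const (show (0 : ℝ) < η / 2 by positivity)).and (eventually_ge_atTop n₀))
  refine ⟨N, fun n hn => ?_⟩
  rw [Real.dist_eq, sub_zero, abs_of_nonneg (hy n)]
  have := key n (hN n hn).2
  have := (hN n hn).1
  linarith

lemma abs_sin_sub_self_le {u : ℝ} (hu : |u| ≤ 1) : |Real.sin u - u| ≤ |u| ^ 3 / 5 := by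
  have h := Real.sin_bound hu
  have h5 : |u| ^ 5 ≤ |u| ^ 3 := pow_le_pow_of_le_one (abs_nonneg u) hu (by norm_num)
  have h3 : |u ^ 3| = |u| ^ 3 := abs_pow u 3
  have : Real.sin u - u = (Real.sin u - (u - u ^ 3 / 6)) - u ^ 3 / 6 := by ring
  rw [this]
  refine (abs_sub _ _).trans ?_
  rw [abs_div, h3, abs_of_pos (show (0 : ℝ) < 6 by norm_num)]
  have := pow_nonneg (abs_nonneg u) 3
  linarith

/-- Second order comparison of the characteristic function of a `±1`-valued variable with mean `d`
and that of a Gaussian variable with mean `d` and unit variance. -/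
lemma abs_cos_sub_add_abs_sin_sub_le (u d : ℝ) (hd : |d| ≤ 1) :
    |Real.cos u - Real.exp (-(u ^ 2 / 2)) * Real.cos (u * d)| +
      |d * Real.sin u - Real.exp (-(u ^ 2 / 2)) * Real.sin (u * d)| ≤
      4 * (u ^ 4 + u ^ 2 * d ^ 2) := by
  set E := Real.exp (-(u ^ 2 / 2)) with hE
  have hE0 : 0 < E := Real.exp_pos _
  have hE1 : E ≤ 1 := Real.exp_le_one_iff.2 (by nlinarith [sq_nonneg u])
  have hElow : 1 - E ≤ u ^ 2 / 2 := by
    have := Real.add_one_le_exp (-(u ^ 2 / 2)); linarith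
  by_cases hu : |u| ≤ 1
  · have hu2 : u ^ 2 ≤ 1 := by rw [← sq_abs]; nlinarith [abs_nonneg u]
    have hu4 : |u| ^ 4 = u ^ 4 := by rw [← abs_pow]; exact abs_of_nonneg (by positivity)
    have hud : |u * d| ≤ |d| * |u| := by rw [abs_mul, mul_comm]
    have hud1 : |u * d| ≤ 1 := by
      rw [abs_mul]; exact mul_le_one₀ hu (abs_nonneg _) hd
    have c1 : |Real.cos u - E| ≤ u ^ 4 * (5 / 96) + u ^ 4 / 4 := by
      have h1 := Real.cos_bound hu
      have h2 := Real.abs_exp_sub_one_sub_id_le (x := -(u ^ 2 / 2)) (by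
        rw [abs_neg, abs_of_nonneg (by positivity)]; linarith)
      rw [← hE] at h2
      rw [hu4] at h1
      rw [abs_le] at *
      constructor <;> nlinarith
    have c2 : |E * (1 - Real.cos (u * d))| ≤ u ^ 2 * d ^ 2 / 2 := by
      have h1 := Real.one_sub_sq_div_two_le_cos (x := u * d)
      have h2 := Real.cos_le_one (u * d)
      rw [abs_of_nonneg (mul_nonneg hE0.le (by linarith))]
      calc _ ≤ 1 * (1 - Real.cos (u * d)) := by gcongr
        _ ≤ _ := by nlinarith
    have hC : |Real.cos u - E * Real.cos (u * d)| ≤ u ^ 4 / 2 + u ^ 2 * d ^ 2 / 2 := by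
      have : Real.cos u - E * Real.cos (u * d) = (Real.cos u - E) + E * (1 - Real.cos (u * d)) := by
        ring
      rw [this]
      refine (abs_add_le _ _).trans ?_
      have : 0 ≤ u ^ 4 := by positivity
      linarith
    have s1 : |d * (Real.sin u - u)| ≤ |d| * (|u| ^ 3 / 5) := by
      rw [abs_mul]; gcongr; exact abs_sin_sub_self_le hu
    have s2 : |u * d * (1 - E)| ≤ |d| * (|u| ^ 3 / 2) := by
      rw [abs_mul, abs_of_nonneg (show 0 ≤ 1 - E by linarith)]
      calc _ ≤ |d| * |u| * (u ^ 2 / 2) := by gcongr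
        _ = _ := by rw [← sq_abs u]; ring
    have s3 : |E * (u * d - Real.sin (u * d))| ≤ |d| * (|u| ^ 3 / 5) := by
      rw [abs_mul, abs_of_pos hE0, abs_sub_comm]
      calc _ ≤ 1 * (|u * d| ^ 3 / 5) := by gcongr; exact abs_sin_sub_self_le hud1
        _ = |d| ^ 3 * (|u| ^ 3 / 5) := by rw [abs_mul]; ring
        _ ≤ _ := by
          gcongr
          exact pow_le_of_le_one (abs_nonneg d) hd (by norm_num)
    have hSn : |d * Real.sin u - E * Real.sin (u * d)| ≤ |d| * |u| ^ 3 := by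
      have : d * Real.sin u - E * Real.sin (u * d) =
          d * (Real.sin u - u) + u * d * (1 - E) + E * (u * d - Real.sin (u * d)) := by ring
      rw [this]
      refine (abs_add_three _ _ _).trans ?_
      have : 0 ≤ |d| * |u| ^ 3 := by positivity
      linarith
    have hAG : |d| * |u| ^ 3 ≤ u ^ 4 + u ^ 2 * d ^ 2 := by
      have h1 : u ^ 2 * d ^ 2 = (|u| * |d|) ^ 2 := by rw [mul_pow, sq_abs, sq_abs]
      rw [← hu4, h1]
      nlinarith [sq_nonneg (|u| ^ 2 - |u| * |d|), sq_nonneg (|u| ^ 2), sq_nonneg (|u| * |d|)]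
    have : 0 ≤ u ^ 4 := by positivity
    have : 0 ≤ u ^ 2 * d ^ 2 := by positivity
    linarith
  · push Not at hu
    have hu4 : 1 ≤ u ^ 4 := by
      rw [show u ^ 4 = |u| ^ 4 by rw [← abs_pow]; exact (abs_of_nonneg (by positivity)).symm]
      exact one_le_pow₀ hu.le
    have hbd : ∀ x y : ℝ, |x| ≤ 1 → |y| ≤ 1 → |x - E * y| ≤ 2 := by
      intro x y hx hy
      refine (abs_sub _ _).trans ?_
      rw [abs_mul, abs_of_pos hE0]
      have := mul_le_one₀ hE1 (abs_nonneg y) hy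
      linarith
    have h1 := hbd _ _ (Real.abs_cos_le_one u) (Real.abs_cos_le_one (u * d))
    have h2 := hbd (d * Real.sin u) _ (by
      rw [abs_mul]; exact mul_le_one₀ hd (abs_nonneg _) (Real.abs_sin_le_one u))
      (Real.abs_sin_le_one (u * d))
    have : 0 ≤ u ^ 2 * d ^ 2 := by positivity
    linarith

/-- Bounded real functions measurable with respect to a given `σ`-algebra. -/
def IsBoundedMeasurable {Ω : Type*} (m : MeasurableSpace Ω) (f : Ω → ℝ) : Prop :=
  Measurable[m] f ∧ ∃ C, ∀ x, |f x| ≤ C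

namespace IsBoundedMeasurable

variable {Ω : Type*} {m m' : MeasurableSpace Ω} {f g : Ω → ℝ}

lemma mono (hf : IsBoundedMeasurable m f) (h : m ≤ m') : IsBoundedMeasurable m' f :=
  ⟨hf.1.mono h le_rfl, hf.2⟩

lemma const (c : ℝ) : IsBoundedMeasurable m (fun _ => c) := ⟨measurable_const, |c|, fun _ => le_rfl⟩

lemma add (hf : IsBoundedMeasurable m f) (hg : IsBoundedMeasurable m g) :
    IsBoundedMeasurable m (fun x => f x + g x) := by
  obtain ⟨⟨hf, C, hC⟩, hg, D, hD⟩ := And.intro hf hg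
  exact ⟨hf.add hg, C + D, fun x => (abs_add_le _ _).trans (add_le_add (hC x) (hD x))⟩

lemma mul (hf : IsBoundedMeasurable m f) (hg : IsBoundedMeasurable m g) :
    IsBoundedMeasurable m (fun x => f x * g x) := by
  obtain ⟨⟨hf, C, hC⟩, hg, D, hD⟩ := And.intro hf hg
  refine ⟨hf.mul hg, C * D, fun x => ?_⟩
  rw [abs_mul]
  exact mul_le_mul (hC x) (hD x) (abs_nonneg _) ((abs_nonneg _).trans (hC x))

lemma const_mul (hf : IsBoundedMeasurable m f) (c : ℝ) :
    IsBoundedMeasurable m (fun x => c * f x) := (const c).mul hf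

lemma sub (hf : IsBoundedMeasurable m f) (hg : IsBoundedMeasurable m g) :
    IsBoundedMeasurable m (fun x => f x - g x) := by
  simpa [sub_eq_add_neg] using hf.add (hg.const_mul (-1))

lemma pow (hf : IsBoundedMeasurable m f) (n : ℕ) : IsBoundedMeasurable m (fun x => f x ^ n) := by
  obtain ⟨hf, C, hC⟩ := hf
  refine ⟨hf.pow_const n, C ^ n, fun x => ?_⟩
  rw [abs_pow]
  exact pow_le_pow_left₀ (abs_nonneg _) (hC x) n

lemma abs (hf : IsBoundedMeasurable m f) : IsBoundedMeasurable m (fun x => |f x|) := by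
  obtain ⟨hf, C, hC⟩ := hf
  refine ⟨?_, C, fun x => by rw [abs_abs]; exact hC x⟩
  exact measurable_norm.comp hf

lemma sum {ι : Type*} {F : ι → Ω → ℝ} (s : Finset ι)
    (hF : ∀ i ∈ s, IsBoundedMeasurable m (F i)) :
    IsBoundedMeasurable m (fun x => ∑ i ∈ s, F i x) := by
  classical
  induction s using Finset.induction_on with
  | empty => simpa using const 0
  | insert i s hi ih =>
    simp only [Finset.sum_insert hi]
    exact (hF i (by simp)).add (ih fun j hj => hF j (by simp [hj]))

lemma integrable (hf : IsBoundedMeasurable m f) (hm : m ≤ m') {μ : Measure[m'] Ω}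
    [IsFiniteMeasure μ] : Integrable f μ := by
  obtain ⟨hf, C, hC⟩ := hf.mono hm
  exact Integrable.of_bound hf.aestronglyMeasurable C (Eventually.of_forall hC)

/-- The Cauchy–Schwarz inequality against the constant function. -/
lemma integral_abs_le_sqrt (hf : IsBoundedMeasurable m f) (hm : m ≤ m') (μ : Measure[m'] Ω)
    [IsProbabilityMeasure μ] : ∫ x, |f x| ∂μ ≤ √(∫ x, f x ^ 2 ∂μ) := by
  apply Real.le_sqrt_of_sq_le
  set c := ∫ x, |f x| ∂μ
  have h0 : 0 ≤ ∫ x, (|f x| - c) ^ 2 ∂μ := integral_nonneg fun x => sq_nonneg _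
  have h1 : ∀ x, (|f x| - c) ^ 2 = f x ^ 2 - 2 * c * |f x| + c ^ 2 := by
    intro x; rw [← sq_abs (f x)]; ring
  simp only [h1] at h0
  rw [integral_add (((hf.pow 2).sub (hf.abs.const_mul _)).integrable hm) (integrable_const _),
    integral_sub ((hf.pow 2).integrable hm) ((hf.abs.const_mul _).integrable hm),
    integral_const_mul, integral_const] at h0
  simp only [probReal_univ, one_smul] at h0
  change 0 ≤ _ - 2 * c * c + c ^ 2 at h0
  linarith

end IsBoundedMeasurable

/-- A nearest-neighbour walk on `ℤ` started at `0` whose conditional drift at time `n` is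
`a * S n / n`, expressed by testing against bounded `ℱ n`-measurable functions. -/
structure IsReinforcedWalk {Ω : Type*} [mΩ : MeasurableSpace Ω] (μ : Measure Ω)
    (ℱ : Filtration ℕ mΩ) (a : ℝ) (S : ℕ → Ω → ℤ) : Prop where
  zero : ∀ x, S 0 x = 0
  step : ∀ n x, S (n + 1) x - S n x = 1 ∨ S (n + 1) x - S n x = -1
  measurable : ∀ n, Measurable[ℱ n] (S n)
  drift : ∀ n (f : Ω → ℝ), IsBoundedMeasurable (ℱ n) f →
    ∫ x, f x * ((S (n + 1) x : ℝ) - S n x) ∂μ = ∫ x, f x * (a * S n x / n) ∂μ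

namespace IsReinforcedWalk

variable {Ω : Type*} [mΩ : MeasurableSpace Ω] {μ : Measure Ω}
  {ℱ : Filtration ℕ mΩ} {a : ℝ} {S : ℕ → Ω → ℤ}

lemma abs_le (hS : IsReinforcedWalk μ ℱ a S) (n : ℕ) (x : Ω) : |S n x| ≤ n := by
  induction n with
  | zero => simp [hS.zero]
  | succ n ih =>
    rw [_root_.abs_le] at *
    push_cast
    rcases hS.step n x with h | h <;> constructor <;> linarith

lemma abs_cast_le (hS : IsReinforcedWalk μ ℱ a S) (n : ℕ) (x : Ω) : |(S n x : ℝ)| ≤ n := by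
  exact_mod_cast hS.abs_le n x

lemma comp (hS : IsReinforcedWalk μ ℱ a S) (g : ℤ → ℝ) (n : ℕ) :
    IsBoundedMeasurable (ℱ n) (fun x => g (S n x)) := by
  refine ⟨(measurable_of_countable g).comp (hS.measurable n),
    ∑ y ∈ Finset.Icc (-(n : ℤ)) n, |g y|, fun x => ?_⟩
  exact Finset.single_le_sum (f := fun y => |g y|) (fun _ _ => abs_nonneg _)
    (Finset.mem_Icc.2 (_root_.abs_le.1 (hS.abs_le n x)))

lemma cast (hS : IsReinforcedWalk μ ℱ a S) (n : ℕ) :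
    IsBoundedMeasurable (ℱ n) (fun x => (S n x : ℝ)) := hS.comp (fun y => (y : ℝ)) n

lemma increment (hS : IsReinforcedWalk μ ℱ a S) (n : ℕ) :
    IsBoundedMeasurable (ℱ (n + 1)) (fun x => (S (n + 1) x : ℝ) - S n x) :=
  (hS.cast (n + 1)).sub ((hS.cast n).mono (ℱ.mono n.le_succ))

lemma drift_bounded (hS : IsReinforcedWalk μ ℱ a S) (n : ℕ) :
    IsBoundedMeasurable (ℱ n) (fun x => a * S n x / n) :=
  hS.comp (fun y => a * y / n) n

lemma increment_sq (hS : IsReinforcedWalk μ ℱ a S) (n : ℕ) (x : Ω) :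
    ((S (n + 1) x : ℝ) - S n x) ^ 2 = 1 := by
  have : (S (n + 1) x - S n x) ^ 2 = 1 := by
    rcases hS.step n x with h | h <;> rw [h] <;> norm_num
  exact_mod_cast this

variable [IsProbabilityMeasure μ]

/-- Recursion for the second moment. -/
lemma integral_sq_succ (hS : IsReinforcedWalk μ ℱ a S) (n : ℕ) :
    ∫ x, (S (n + 1) x : ℝ) ^ 2 ∂μ = (1 + 2 * a / n) * ∫ x, (S n x : ℝ) ^ 2 ∂μ + 1 := by
  have h1 : ∀ x, (S (n + 1) x : ℝ) ^ 2 =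
      (S n x : ℝ) ^ 2 + 2 * (S n x * ((S (n + 1) x : ℝ) - S n x)) + 1 := by
    intro x; have := hS.increment_sq n x; linarith
  have hi := ((hS.cast n).mono (ℱ.mono n.le_succ)).mul (hS.increment n)
  simp only [h1]
  have hq := (((hS.cast n).mono (ℱ.mono n.le_succ)).pow 2).add (hi.const_mul 2)
  rw [integral_add (hq.integrable (ℱ.le _)) (integrable_const _),
    integral_add (((hS.cast n).pow 2).integrable (ℱ.le _)) ((hi.const_mul 2).integrable (ℱ.le _)),
    integral_const_mul, hS.drift n _ (hS.cast n)]
  have h2 : ∀ x, (S n x : ℝ) * (a * S n x / n) = a / n * (S n x : ℝ) ^ 2 := fun x => by ring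
  simp only [h2, integral_const_mul, integral_const, probReal_univ, one_smul]
  ring

/-- The variance of the walk is asymptotically linear. -/
lemma tendsto_integral_sq_div (hS : IsReinforcedWalk μ ℱ a S) (ha : a < 1 / 2) :
    Tendsto (fun n : ℕ => (∫ x, (S n x : ℝ) ^ 2 ∂μ) / n) atTop (𝓝 (1 - 2 * a)⁻¹) := by
  have hδ : 0 < 1 - 2 * a := by linarith
  rw [tendsto_iff_dist_tendsto_zero]
  refine tendsto_zero_of_le_one_sub_div_mul_add (e := fun _ => 0) hδ (fun n => dist_nonneg)
    tendsto_const_nhds ?_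
  filter_upwards [eventually_ge_atTop 1, eventually_ge_atTop ⌈1 - 2 * a⌉₊] with n hn hn'
  have hn0 : (0 : ℝ) < n := by exact_mod_cast hn
  have hn1 : (0 : ℝ) < n + 1 := by positivity
  have hc : 0 ≤ 1 - (1 - 2 * a) / ((n : ℝ) + 1) := by
    rw [sub_nonneg, div_le_one hn1]
    have : (⌈1 - 2 * a⌉₊ : ℝ) ≤ n := by exact_mod_cast hn'
    linarith [Nat.le_ceil (1 - 2 * a)]
  rw [Real.dist_eq, Real.dist_eq, hS.integral_sq_succ]
  set s := ∫ x, (S n x : ℝ) ^ 2 ∂μ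
  rw [zero_div, add_zero]
  have habs : (1 - (1 - 2 * a) / ((n : ℝ) + 1)) * |s / n - (1 - 2 * a)⁻¹| =
      |(1 - (1 - 2 * a) / ((n : ℝ) + 1)) * (s / n - (1 - 2 * a)⁻¹)| := by
    rw [abs_mul, abs_of_nonneg hc]
  rw [habs]
  refine le_of_eq (congrArg _ ?_)
  push_cast
  field_simp
  ring

lemma exists_integral_sq_le (hS : IsReinforcedWalk μ ℱ a S) (ha : a < 1 / 2) :
    ∃ K : ℝ, 0 < K ∧ ∀ n : ℕ, ∫ x, (S n x : ℝ) ^ 2 ∂μ ≤ K * n := by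
  obtain ⟨K, hK⟩ := (hS.tendsto_integral_sq_div ha).bddAbove_range
  refine ⟨max K 1, by positivity, fun n => ?_⟩
  rcases Nat.eq_zero_or_pos n with rfl | hn
  · simp [hS.zero]
  · have hn0 : (0 : ℝ) < n := by exact_mod_cast hn
    rw [← div_le_iff₀ hn0]
    exact (hK ⟨n, rfl⟩).trans (le_max_left _ _)

lemma integral_abs_le (hS : IsReinforcedWalk μ ℱ a S) {K : ℝ}
    (hK : ∀ n : ℕ, ∫ x, (S n x : ℝ) ^ 2 ∂μ ≤ K * n) (n : ℕ) :
    ∫ x, |(S n x : ℝ)| ∂μ ≤ √(K * n) :=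
  ((hS.cast n).integral_abs_le_sqrt (ℱ.le n) μ).trans (Real.sqrt_le_sqrt (hK n))

/-- Second moment bound for martingale transforms of the compensated walk. -/
lemma integral_transform_sq_le (hS : IsReinforcedWalk μ ℱ a S) {c : ℕ → Ω → ℝ}
    (hc : ∀ k, IsBoundedMeasurable (ℱ k) (c k)) (n : ℕ) :
    ∫ x, (∑ k ∈ Finset.range n, c k x * ((S (k + 1) x : ℝ) - S k x - a * S k x / k)) ^ 2 ∂μ ≤
      ∑ k ∈ Finset.range n, ∫ x, c k x ^ 2 ∂μ := by
  have hM : ∀ n, IsBoundedMeasurable (ℱ n) (fun x => ∑ k ∈ Finset.range n,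
      c k x * ((S (k + 1) x : ℝ) - S k x - a * S k x / k)) := by
    intro n
    refine IsBoundedMeasurable.sum _ fun k hk => ?_
    have hk : k + 1 ≤ n := Finset.mem_range.1 hk
    exact ((hc k).mono (ℱ.mono (by omega))).mul (((hS.increment k).mono (ℱ.mono hk)).sub
      ((hS.drift_bounded k).mono (ℱ.mono (by omega))))
  induction n with
  | zero => simp
  | succ n ih =>
    set M : Ω → ℝ := fun x => ∑ k ∈ Finset.range n,
      c k x * ((S (k + 1) x : ℝ) - S k x - a * S k x / k) with hMdef
    have hMn : IsBoundedMeasurable (ℱ n) M := hM n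
    set v : Ω → ℝ := fun x => (S (n + 1) x : ℝ) - S n x with hv
    set d : Ω → ℝ := fun x => a * S n x / n with hd
    have hvb : IsBoundedMeasurable (ℱ (n + 1)) v := hS.increment n
    have hdb : IsBoundedMeasurable (ℱ n) d := hS.drift_bounded n
    set f : Ω → ℝ := fun x => 2 * (M x * c n x) - 2 * (c n x ^ 2 * d x) with hf
    have hfb : IsBoundedMeasurable (ℱ n) f :=
      ((hMn.mul (hc n)).const_mul 2).sub ((((hc n).pow 2).mul hdb).const_mul 2)
    have hup : ∀ {g : Ω → ℝ}, IsBoundedMeasurable (ℱ n) g → IsBoundedMeasurable (ℱ (n + 1)) g :=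
      fun hg => hg.mono (ℱ.mono n.le_succ)
    have hexp : ∀ x, (∑ k ∈ Finset.range (n + 1),
        c k x * ((S (k + 1) x : ℝ) - S k x - a * S k x / k)) ^ 2 =
        (M x ^ 2 + c n x ^ 2) + (f x * v x - f x * d x) - c n x ^ 2 * d x ^ 2 := by
      intro x
      have h1 : v x ^ 2 = 1 := hS.increment_sq n x
      rw [Finset.sum_range_succ]
      change (M x + c n x * (v x - d x)) ^ 2 = _
      simp only [hf]
      linear_combination (c n x ^ 2) * h1
    have hdrift : ∫ x, f x * v x ∂μ = ∫ x, f x * d x ∂μ := hS.drift n f hfb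
    have i1 := ((hMn.pow 2).add ((hc n).pow 2)).integrable (ℱ.le _) (μ := μ)
    have i2 := ((hup hfb).mul hvb).integrable (ℱ.le _) (μ := μ)
    have i3 := (hfb.mul hdb).integrable (ℱ.le _) (μ := μ)
    have i5 := (((hup hfb).mul hvb).sub (hup (hfb.mul hdb))).integrable (ℱ.le _) (μ := μ)
    have i6 := ((hup ((hMn.pow 2).add ((hc n).pow 2))).add
      (((hup hfb).mul hvb).sub (hup (hfb.mul hdb)))).integrable (ℱ.le _) (μ := μ)
    have i4 := (((hc n).pow 2).mul (hdb.pow 2)).integrable (ℱ.le _) (μ := μ)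
    simp only [hexp]
    rw [integral_sub i6 i4, integral_add i1 i5, integral_sub i2 i3,
      hdrift, sub_self, add_zero,
      integral_add ((hMn.pow 2).integrable (ℱ.le _)) (((hc n).pow 2).integrable (ℱ.le _)),
      Finset.sum_range_succ]
    have h0 : 0 ≤ ∫ x, c n x ^ 2 * d x ^ 2 ∂μ := integral_nonneg fun x => by positivity
    linarith

end IsReinforcedWalk

/-- The solution of `y (n + 1) = r n * y n + e n` started at `0`. -/
def affineRec (r e : ℕ → ℝ) : ℕ → ℝ
  | 0 => 0
  | n + 1 => r n * affineRec r e n + e n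

lemma affineRec_nonneg {r e : ℕ → ℝ} (hr : ∀ n, 0 ≤ r n) (he : ∀ n, 0 ≤ e n) (n : ℕ) :
    0 ≤ affineRec r e n := by
  induction n with
  | zero => exact le_rfl
  | succ n ih => exact add_nonneg (mul_nonneg (hr n) ih) (he n)

/-- If `(1 + a / n) ^ 2` with `a < 1 / 2` governs a recursion for `y`, then `y n` grows slower
than `n`; similarly `y n` grows slower than `n ^ j` under `(1 + a / n) ^ (2 * j)`. -/
lemma tendsto_affineRec_div_pow {a : ℝ} (ha : a < 1 / 2) {j : ℕ} (hj : j ≠ 0) {e : ℕ → ℝ}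
    (he0 : ∀ n, 0 ≤ e n) (he : Tendsto (fun n : ℕ => e n / (n + 1 : ℝ) ^ (j - 1)) atTop (𝓝 0)) :
    Tendsto (fun n : ℕ => affineRec (fun n => (1 + a / n) ^ (2 * j)) e n / (n : ℝ) ^ j)
      atTop (𝓝 0) := by
  have hδ : 0 < (1 - 2 * a) / 2 := by linarith
  set y := affineRec (fun n => (1 + a / n) ^ (2 * j)) e with hy
  have hy0 : ∀ n, 0 ≤ y n := affineRec_nonneg (fun n => by rw [pow_mul]; positivity) he0
  refine tendsto_zero_of_le_one_sub_div_mul_add hδ (fun n => by have := hy0 n; positivity) he ?_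
  filter_upwards [eventually_ge_atTop 1, eventually_ge_atTop ⌈a ^ 2 / ((1 - 2 * a) / 2)⌉₊]
    with n hn hn'
  have hn0 : (0 : ℝ) < n := by exact_mod_cast hn
  have hn1 : (0 : ℝ) < n + 1 := by positivity
  have hna : a ^ 2 / n ≤ (1 - 2 * a) / 2 := by
    rw [div_le_comm₀ hn0 hδ]
    exact (Nat.le_ceil _).trans (by exact_mod_cast hn')
  have hr0 : 0 ≤ (1 + a / n) ^ 2 * (n / (n + 1)) := by positivity
  have hr : (1 + a / n) ^ 2 * (n / (n + 1)) ≤ 1 - (1 - 2 * a) / 2 / (n + 1) := by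
    have : (1 + a / n) ^ 2 * (n / (n + 1)) = (n + 2 * a + a ^ 2 / n) / (n + 1) := by
      field_simp
      ring
    rw [this, show 1 - (1 - 2 * a) / 2 / ((n : ℝ) + 1) = (n + 1 - (1 - 2 * a) / 2) / (n + 1) by
      field_simp]
    gcongr
    linarith
  have hr1 : (1 + a / n) ^ 2 * (n / (n + 1)) ≤ 1 := by
    have : 0 < (1 - 2 * a) / 2 / ((n : ℝ) + 1) := by positivity
    linarith
  have hrj : ((1 + a / n) ^ 2 * (n / (n + 1))) ^ j ≤ 1 - (1 - 2 * a) / 2 / (n + 1) :=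
    (pow_le_of_le_one hr0 hr1 hj).trans hr
  have hs : y (n + 1) = (1 + a / n) ^ (2 * j) * y n + e n := rfl
  obtain ⟨i, rfl⟩ := Nat.exists_eq_succ_of_ne_zero hj
  calc y (n + 1) / ((n + 1 : ℕ) : ℝ) ^ (i + 1)
      = ((1 + a / n) ^ 2 * (n / (n + 1))) ^ (i + 1) * (y n / (n : ℝ) ^ (i + 1))
        + e n / ((n : ℝ) + 1) ^ i / (n + 1) := by
        rw [hs, mul_pow, ← pow_mul, div_pow]
        push_cast
        field_simp
        ring
    _ ≤ _ := by
      have := hy0 n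
      simp only [Nat.succ_eq_add_one, Nat.add_sub_cancel] at hrj ⊢
      gcongr

namespace IsReinforcedWalk

variable {Ω : Type*} [mΩ : MeasurableSpace Ω] {μ : Measure Ω} [IsProbabilityMeasure μ]
  {ℱ : Filtration ℕ mΩ} {a : ℝ} {S : ℕ → Ω → ℤ}

/-- One step of the walk acts on trigonometric integrals as an independent Gaussian increment,
up to an error controlled by the second moment. -/
lemma abs_integral_cos_succ_sub_le (hS : IsReinforcedWalk μ ℱ a S) (ha : |a| ≤ 1) (n : ℕ)
    (u θ : ℝ) :
    |∫ x, Real.cos (u * S (n + 1) x + θ) ∂μ -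
        Real.exp (-(u ^ 2 / 2)) * ∫ x, Real.cos (u * (1 + a / n) * S n x + θ) ∂μ| ≤
      4 * (u ^ 4 + u ^ 2 * ((∫ x, (S n x : ℝ) ^ 2 ∂μ) / n ^ 2)) := by
  set E := Real.exp (-(u ^ 2 / 2)) with hE
  have hcos : ∀ x, Real.cos (u * S (n + 1) x + θ) = Real.cos u * Real.cos (u * S n x + θ) -
      Real.sin u * (Real.sin (u * S n x + θ) * ((S (n + 1) x : ℝ) - S n x)) := by
    intro x
    have h1 : u * (S (n + 1) x : ℝ) + θ = (u * S n x + θ) + u * ((S (n + 1) x : ℝ) - S n x) := by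
      ring
    have h2 : (S (n + 1) x : ℝ) - S n x = 1 ∨ (S (n + 1) x : ℝ) - S n x = -1 := by
      exact_mod_cast hS.step n x
    rw [h1, Real.cos_add]
    rcases h2 with h | h <;> rw [h]
    · simp only [mul_one]; ring
    · simp only [mul_neg, mul_one, Real.cos_neg, Real.sin_neg]; ring
  have bc := hS.comp (fun y => Real.cos (u * y + θ)) n
  have bs := hS.comp (fun y => Real.sin (u * y + θ)) n
  have bsv := (bs.mono (ℱ.mono n.le_succ)).mul (hS.increment n)
  have bsd := bs.mul (hS.drift_bounded n)
  have bc' := hS.comp (fun y => Real.cos (u * (1 + a / n) * y + θ)) n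
  have bdiff := ((bc.const_mul (Real.cos u)).sub (bsd.const_mul (Real.sin u)))
  have heq : ∫ x, Real.cos (u * S (n + 1) x + θ) ∂μ -
      E * ∫ x, Real.cos (u * (1 + a / n) * S n x + θ) ∂μ
      = ∫ x, (Real.cos u * Real.cos (u * S n x + θ) -
        Real.sin u * (Real.sin (u * S n x + θ) * (a * S n x / n)) -
        E * Real.cos (u * (1 + a / n) * S n x + θ)) ∂μ := by
    simp only [hcos]
    rw [integral_sub ((bc.const_mul _).integrable (ℱ.le _)) ((bsv.const_mul _).integrable (ℱ.le _)),
      integral_sub (bdiff.integrable (ℱ.le _)) ((bc'.const_mul _).integrable (ℱ.le _)),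
      integral_sub ((bc.const_mul _).integrable (ℱ.le _)) ((bsd.const_mul _).integrable (ℱ.le _)),
      integral_const_mul, integral_const_mul, integral_const_mul, integral_const_mul,
      hS.drift n _ bs]
  have hd1 : ∀ x, |a * (S n x : ℝ) / n| ≤ 1 := by
    intro x
    rw [abs_div, abs_mul, Nat.abs_cast]
    refine div_le_one_of_le₀ ?_ (Nat.cast_nonneg n)
    calc |a| * |(S n x : ℝ)| ≤ 1 * n := by gcongr; exact hS.abs_cast_le n x
      _ = n := one_mul _
  have hpt : ∀ x, |Real.cos u * Real.cos (u * S n x + θ) -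
        Real.sin u * (Real.sin (u * S n x + θ) * (a * S n x / n)) -
        E * Real.cos (u * (1 + a / n) * S n x + θ)| ≤
        4 * (u ^ 4 + u ^ 2 * ((S n x : ℝ) ^ 2 / n ^ 2)) := by
    intro x
    set d := a * (S n x : ℝ) / n with hd
    have h1 : u * (1 + a / n) * S n x + θ = (u * S n x + θ) + u * d := by rw [hd]; ring
    rw [h1, Real.cos_add (u * S n x + θ) (u * d)]
    have h2 := abs_cos_sub_add_abs_sin_sub_le u d (hd1 x)
    rw [← hE] at h2
    set C := Real.cos (u * S n x + θ)
    set D := Real.sin (u * S n x + θ)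
    have hC : |C| ≤ 1 := Real.abs_cos_le_one _
    have hD : |D| ≤ 1 := Real.abs_sin_le_one _
    have h3 : Real.cos u * C - Real.sin u * (D * d) -
        E * (C * Real.cos (u * d) - D * Real.sin (u * d)) =
        C * (Real.cos u - E * Real.cos (u * d)) - D * (d * Real.sin u - E * Real.sin (u * d)) := by
      ring
    have h4 : d ^ 2 ≤ (S n x : ℝ) ^ 2 / n ^ 2 := by
      rw [hd, div_pow, mul_pow]
      gcongr
      have : a ^ 2 ≤ 1 := by rw [← sq_abs]; exact pow_le_one₀ (abs_nonneg a) ha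
      nlinarith [sq_nonneg (S n x : ℝ)]
    rw [h3]
    calc _ ≤ |C| * |Real.cos u - E * Real.cos (u * d)| +
          |D| * |d * Real.sin u - E * Real.sin (u * d)| := by
            rw [← abs_mul, ← abs_mul]; exact abs_sub _ _
      _ ≤ 1 * |Real.cos u - E * Real.cos (u * d)| +
          1 * |d * Real.sin u - E * Real.sin (u * d)| := by gcongr
      _ ≤ 4 * (u ^ 4 + u ^ 2 * d ^ 2) := by linarith
      _ ≤ _ := by gcongr
  rw [heq]
  have bsq := hS.comp (fun y => 4 * (u ^ 4 + u ^ 2 * ((y : ℝ) ^ 2 / n ^ 2))) n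
  refine abs_integral_le_integral_abs.trans ?_
  refine (integral_mono ((bdiff.sub (bc'.const_mul E)).abs.integrable (ℱ.le _))
    (bsq.integrable (ℱ.le _)) hpt).trans (le_of_eq ?_)
  have bq := hS.comp (fun y => u ^ 2 * ((y : ℝ) ^ 2 / n ^ 2)) n
  rw [integral_const_mul, integral_add (integrable_const _) (bq.integrable (ℱ.le _)),
    integral_const_mul, integral_div]
  simp

/-- Quantitative comparison of the characteristic function of the walk with a Gaussian one. -/
lemma abs_integral_cos_sub_le (hS : IsReinforcedWalk μ ℱ a S) (ha : |a| ≤ 1) (n : ℕ) (u θ : ℝ) :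
    |∫ x, Real.cos (u * S n x + θ) ∂μ -
        Real.cos θ * Real.exp (-((∫ x, (S n x : ℝ) ^ 2 ∂μ) * u ^ 2 / 2))| ≤
      5 * (affineRec (fun n => (1 + a / n) ^ (2 * 2)) (fun _ => 1) n * u ^ 4 +
        affineRec (fun n => (1 + a / n) ^ (2 * 1))
          (fun n => (∫ x, (S n x : ℝ) ^ 2 ∂μ) / n ^ 2) n * u ^ 2) := by
  induction n generalizing u with
  | zero => simp [hS.zero, affineRec]
  | succ n ih =>
    have hstep := hS.abs_integral_cos_succ_sub_le ha n u θ
    have hprev := ih (u * (1 + a / n))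
    have hsucc := hS.integral_sq_succ n
    simp only [affineRec]
    set A := affineRec (fun n => (1 + a / n) ^ (2 * 2)) (fun _ => 1) n
    set B := affineRec (fun n => (1 + a / n) ^ (2 * 1))
          (fun n => (∫ x, (S n x : ℝ) ^ 2 ∂μ) / n ^ 2) n
    set s := ∫ x, (S n x : ℝ) ^ 2 ∂μ with hs
    set E := Real.exp (-(u ^ 2 / 2)) with hE
    have hs0 : 0 ≤ s := integral_nonneg fun x => sq_nonneg _
    have hE0 : 0 < E := Real.exp_pos _
    have hE1 : E ≤ 1 := Real.exp_le_one_iff.2 (by nlinarith [sq_nonneg u])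
    set ψ := ∫ x, Real.cos (u * (1 + a / n) * S n x + θ) ∂μ
    set G := Real.exp (-(s * (u * (1 + a / n)) ^ 2 / 2))
    have hG : |E * G - Real.exp (-((∫ x, (S (n + 1) x : ℝ) ^ 2 ∂μ) * u ^ 2 / 2))| ≤
        u ^ 2 * (s / n ^ 2) := by
      rw [← Real.exp_add, hsucc]
      set p := -(((1 + 2 * a / n) * s + 1) * u ^ 2 / 2) with hp
      set r := s / n ^ 2 * a ^ 2 * u ^ 2 / 2 with hr
      have hpr : -(u ^ 2 / 2) + -(s * (u * (1 + a / n)) ^ 2 / 2) = p - r := by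
        rw [hp, hr]; ring
      have hp0 : p ≤ 0 := by
        rw [hp, ← hsucc, neg_nonpos]
        have : 0 ≤ ∫ x, (S (n + 1) x : ℝ) ^ 2 ∂μ := integral_nonneg fun x => sq_nonneg _
        positivity
      have hr0 : 0 ≤ r := by positivity
      have hru : r ≤ u ^ 2 * (s / n ^ 2) := by
        have ha2 : a ^ 2 ≤ 1 := by rw [← sq_abs]; exact pow_le_one₀ (abs_nonneg a) ha
        have : 0 ≤ s / n ^ 2 * u ^ 2 := by positivity
        rw [hr]
        nlinarith
      have hexp : Real.exp (p - r) = Real.exp p * Real.exp (-r) := by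
        rw [← Real.exp_add, sub_eq_add_neg]
      have hr1 : Real.exp (-r) ≤ 1 := Real.exp_le_one_iff.2 (by linarith)
      rw [hpr, hexp, abs_sub_comm,
        show Real.exp p - Real.exp p * Real.exp (-r) = Real.exp p * (1 - Real.exp (-r)) by ring,
        abs_of_nonneg (mul_nonneg (Real.exp_pos p).le (by linarith))]
      calc _ ≤ 1 * (1 - Real.exp (-r)) := by
            gcongr
            exact Real.exp_le_one_iff.2 hp0
        _ ≤ r := by have := Real.add_one_le_exp (-r); linarith
        _ ≤ _ := hru
    have hEG : |E * ψ - Real.cos θ * (E * G)| ≤ |ψ - Real.cos θ * G| := by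
      rw [show E * ψ - Real.cos θ * (E * G) = E * (ψ - Real.cos θ * G) by ring, abs_mul,
        abs_of_pos hE0]
      exact mul_le_of_le_one_left (abs_nonneg _) hE1
    have hcG : |Real.cos θ * (E * G) -
        Real.cos θ * Real.exp (-((∫ x, (S (n + 1) x : ℝ) ^ 2 ∂μ) * u ^ 2 / 2))| ≤
        u ^ 2 * (s / n ^ 2) := by
      rw [← mul_sub, abs_mul]
      exact (mul_le_of_le_one_left (abs_nonneg _) (Real.abs_cos_le_one θ)).trans hG
    have h3 := abs_sub_le (∫ x, Real.cos (u * S (n + 1) x + θ) ∂μ) (E * ψ)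
      (Real.cos θ * Real.exp (-((∫ x, (S (n + 1) x : ℝ) ^ 2 ∂μ) * u ^ 2 / 2)))
    have h4 := abs_sub_le (E * ψ) (Real.cos θ * (E * G))
      (Real.cos θ * Real.exp (-((∫ x, (S (n + 1) x : ℝ) ^ 2 ∂μ) * u ^ 2 / 2)))
    have hu4 : 0 ≤ u ^ 4 := by positivity
    calc _ ≤ 4 * (u ^ 4 + u ^ 2 * (s / n ^ 2)) +
          (5 * (A * (u * (1 + a / n)) ^ 4 + B * (u * (1 + a / n)) ^ 2) + u ^ 2 * (s / n ^ 2)) := by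
            linarith
      _ ≤ _ := by
        have : 5 * (((1 + a / n) ^ (2 * 2) * A + 1) * u ^ 4 +
          ((1 + a / n) ^ (2 * 1) * B + s / n ^ 2) * u ^ 2) =
          5 * (A * (u * (1 + a / n)) ^ 4 + B * (u * (1 + a / n)) ^ 2) + 5 * u ^ 4 +
            5 * (u ^ 2 * (s / n ^ 2)) := by ring
        rw [this]
        linarith

lemma tendsto_integral_cos (hS : IsReinforcedWalk μ ℱ a S) (ha : |a| ≤ 1) (ha2 : a < 1 / 2)
    (u θ : ℝ) :
    Tendsto (fun n : ℕ => ∫ x, Real.cos (u * (S n x / √n) + θ) ∂μ) atTop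
      (𝓝 (Real.cos θ * Real.exp (-((1 - 2 * a)⁻¹ * u ^ 2 / 2)))) := by
  have hs := hS.tendsto_integral_sq_div ha2
  have hA := tendsto_affineRec_div_pow ha2 (j := 2) (by norm_num) (e := fun _ => 1)
    (fun _ => zero_le_one) (by simpa using tendsto_one_div_add_atTop_nhds_zero_nat (𝕜 := ℝ))
  have hB := tendsto_affineRec_div_pow ha2 (j := 1) (by norm_num)
    (e := fun n => (∫ x, (S n x : ℝ) ^ 2 ∂μ) / n ^ 2)
    (fun n => div_nonneg (integral_nonneg fun x => sq_nonneg _) (by positivity)) (by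
      simp only [Nat.sub_self, pow_zero, div_one]
      have := hs.mul (tendsto_one_div_atTop_nhds_zero_nat (𝕜 := ℝ))
      rw [mul_zero] at this
      refine this.congr fun n => ?_
      rw [div_mul_div_comm, mul_one, sq])
  have hlim : Tendsto (fun n : ℕ => Real.cos θ *
      Real.exp (-((∫ x, (S n x : ℝ) ^ 2 ∂μ) / n * u ^ 2 / 2))) atTop
      (𝓝 (Real.cos θ * Real.exp (-((1 - 2 * a)⁻¹ * u ^ 2 / 2)))) :=
    ((Real.continuous_exp.tendsto _).comp ((hs.mul_const _).div_const _).neg).const_mul _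
  have herr := ((hA.mul_const (u ^ 4)).add (hB.mul_const (u ^ 2))).const_mul 5
  simp only [zero_mul, add_zero, mul_zero] at herr
  rw [tendsto_iff_dist_tendsto_zero]
  rw [tendsto_iff_dist_tendsto_zero] at hlim
  have hsum := herr.add hlim
  rw [add_zero] at hsum
  refine squeeze_zero' (Eventually.of_forall fun n => dist_nonneg) ?_ hsum
  filter_upwards [eventually_ge_atTop 1] with n hn
  have hn0 : (0 : ℝ) < n := by exact_mod_cast hn
  refine (dist_triangle _ _ _).trans (add_le_add_left ?_ _)
  rw [Real.dist_eq]
  have h := hS.abs_integral_cos_sub_le ha n (u / √n) θ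
  have h2 : (u / √n) ^ 2 = u ^ 2 / n := by rw [div_pow, Real.sq_sqrt hn0.le]
  have h4 : (u / √n) ^ 4 = u ^ 4 / n ^ 2 := by
    rw [show (u / √n) ^ 4 = ((u / √n) ^ 2) ^ 2 by ring, h2]; ring
  rw [h2, h4] at h
  have hint : ∀ x, u * ((S n x : ℝ) / √n) + θ = u / √n * S n x + θ := fun x => by ring
  simp only [hint]
  refine le_trans (le_of_eq ?_) (h.trans (le_of_eq ?_))
  · rw [div_mul_eq_mul_div, mul_div_assoc]
  · ring

/-- Central limit theorem for the reinforced walk, in terms of distribution functions. -/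
lemma tendsto_measure_div_sqrt_le (hS : IsReinforcedWalk μ ℱ a S) (ha : |a| ≤ 1)
    (ha2 : a < 1 / 2) {ℓ : ℝ} (hℓ : 0 < ℓ) (x : ℝ) :
    Tendsto (fun n : ℕ => μ.real {b | √ℓ * (S n b / √n) ≤ x}) atTop
      (𝓝 ((gaussianReal 0 (Real.toNNReal (ℓ * (1 - 2 * a)⁻¹))).real (Iic x))) := by
  have hσ : 0 < (1 - 2 * a)⁻¹ := inv_pos.2 (by linarith)
  set v := Real.toNNReal (ℓ * (1 - 2 * a)⁻¹) with hv
  have hv' : (v : ℝ) = ℓ * (1 - 2 * a)⁻¹ := Real.coe_toNNReal _ (by positivity)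
  have hv0 : v ≠ 0 := by
    intro h
    rw [h] at hv'
    have : 0 < ℓ * (1 - 2 * a)⁻¹ := by positivity
    simp at hv'
    rcases hv' with h | h <;> linarith
  set Y : ℕ → Ω → ℝ := fun n b => √ℓ * (S n b / √n) with hY
  have hYb : ∀ n, IsBoundedMeasurable (ℱ n) (Y n) := fun n => hS.comp (fun y => √ℓ * (y / √n)) n
  have hYm : ∀ n, Measurable (Y n) := fun n => ((hYb n).mono (ℱ.le n)).1
  let P : ℕ → ProbabilityMeasure ℝ := fun n =>
    ⟨μ.map (Y n), Measure.isProbabilityMeasure_map (hYm n).aemeasurable⟩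
  let G : ProbabilityMeasure ℝ := ⟨gaussianReal 0 v, inferInstance⟩
  have hconv : Tendsto P atTop (𝓝 G) := by
    refine ProbabilityMeasure.tendsto_iff_tendsto_charFun.2 fun t => ?_
    have hc := hS.tendsto_integral_cos ha ha2 (t * √ℓ) 0
    have hs := hS.tendsto_integral_cos ha ha2 (t * √ℓ) (-(Real.pi / 2))
    have hcs := ((Complex.continuous_ofReal.tendsto _).comp hc).add
      (((Complex.continuous_ofReal.tendsto _).comp hs).mul_const Complex.I)
    have hG : charFun (G : Measure ℝ) t =
        ((Real.cos 0 * Real.exp (-((1 - 2 * a)⁻¹ * (t * √ℓ) ^ 2 / 2)) : ℝ) : ℂ) +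
        ((Real.cos (-(Real.pi / 2)) * Real.exp (-((1 - 2 * a)⁻¹ * (t * √ℓ) ^ 2 / 2)) : ℝ) : ℂ)
          * Complex.I := by
      change charFun (gaussianReal 0 v) t = _
      rw [charFun_gaussianReal]
      simp only [Real.cos_zero, one_mul, Real.cos_neg, Real.cos_pi_div_two, zero_mul,
        Complex.ofReal_zero, add_zero, Complex.ofReal_exp]
      congr 1
      have : ((v : ℝ) : ℂ) = ((ℓ * (1 - 2 * a)⁻¹ : ℝ) : ℂ) := by rw [hv']
      rw [this, mul_pow, Real.sq_sqrt hℓ.le]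
      push_cast
      ring
    rw [hG]
    refine hcs.congr fun n => ?_
    change _ = charFun (μ.map (Y n)) t
    rw [charFun_apply_real, integral_map (hYm n).aemeasurable (by fun_prop)]
    have hexp : ∀ b, Complex.exp (t * (Y n b) * Complex.I) =
        ((Real.cos (t * √ℓ * (S n b / √n) + 0) : ℝ) : ℂ) +
        ((Real.cos (t * √ℓ * (S n b / √n) + -(Real.pi / 2)) : ℝ) : ℂ) * Complex.I := by
      intro b
      have h1 : Real.cos (t * √ℓ * (S n b / √n) + -(Real.pi / 2)) = Real.sin (t * Y n b) := by
        rw [← sub_eq_add_neg, Real.cos_sub_pi_div_two, hY, mul_assoc]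
      have h2 : t * √ℓ * (S n b / √n) + 0 = t * Y n b := by rw [add_zero, hY, mul_assoc]
      rw [h1, h2, Complex.exp_mul_I]
      push_cast
      rfl
    have b1 := hS.comp (fun y => Real.cos (t * √ℓ * (y / √n) + 0)) n
    have b2 := hS.comp (fun y => Real.cos (t * √ℓ * (y / √n) + -(Real.pi / 2))) n
    simp only [hexp]
    rw [integral_add (b1.integrable (ℱ.le n)).ofReal
      ((b2.integrable (ℱ.le n)).ofReal.mul_const _), integral_mul_const]
    exact congrArg₂ (fun z w : ℂ => z + w * Complex.I) integral_complex_ofReal.symm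
      integral_complex_ofReal.symm
  have hfr : G (frontier (Iic x)) = 0 := by
    have : NullSingletonClass (gaussianReal 0 v) := nullSingletonClass_gaussianReal hv0
    have h0 : (gaussianReal 0 v) {x} = 0 := measure_singleton x
    rw [frontier_Iic]
    exact ENNReal.toNNReal_eq_zero_iff _ |>.2 (Or.inl h0)
  have hres := ProbabilityMeasure.tendsto_measure_of_null_frontier_of_tendsto hconv hfr
  have hres' := (NNReal.continuous_coe.tendsto _).comp hres
  refine hres'.congr fun n => ?_
  change ((μ.map (Y n)) (Iic x)).toReal = _
  rw [Measure.map_apply (hYm n) measurableSet_Iic]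
  rfl

end IsReinforcedWalk

/-- The function vanishing at `0` whose increment between `y` and `y + 1` is `h y + h (y + 1)`. -/
noncomputable def midpointSum (h : ℤ → ℝ) (y : ℤ) : ℝ :=
  ∑ i ∈ Finset.Ico 0 y, (h i + h (i + 1)) - ∑ i ∈ Finset.Ico y 0, (h i + h (i + 1))

lemma midpointSum_zero (h : ℤ → ℝ) : midpointSum h 0 = 0 := by simp [midpointSum]

lemma midpointSum_add_one (h : ℤ → ℝ) (y : ℤ) :
    midpointSum h (y + 1) = midpointSum h y + (h y + h (y + 1)) := by
  unfold midpointSum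
  rcases le_or_gt 0 y with hy | hy
  · have h1 : Finset.Ico 0 (y + 1) = insert y (Finset.Ico 0 y) := by
      ext i; simp only [Finset.mem_Ico, Finset.mem_insert]; omega
    rw [h1, Finset.sum_insert (by simp), Finset.Ico_eq_empty (show ¬ y + 1 < 0 by omega),
      Finset.Ico_eq_empty (show ¬ y < 0 by omega)]
    simp; ring
  · have h1 : Finset.Ico y 0 = insert y (Finset.Ico (y + 1) 0) := by
      ext i; simp only [Finset.mem_Ico, Finset.mem_insert]; omega
    rw [h1, Finset.sum_insert (by simp), Finset.Ico_eq_empty (show ¬ 0 < y + 1 by omega),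
      Finset.Ico_eq_empty (show ¬ 0 < y by omega)]
    simp; ring

lemma abs_midpointSum_le {h : ℤ → ℝ} {ε C : ℝ} (hε : 0 ≤ ε)
    (hh : ∀ y, |h y| ≤ ε * |(y : ℝ)| + C) (y : ℤ) :
    |midpointSum h y| ≤ 2 * |(y : ℝ)| * (ε * |(y : ℝ)| + C) := by
  induction y using Int.induction_on with
  | zero => simp [midpointSum_zero]
  | succ n ih =>
    rw [midpointSum_add_one]
    have h1 := hh n
    have h2 := hh (n + 1)
    have h3 := abs_add_three (midpointSum h n) (h n) (h (n + 1))
    rw [← add_assoc]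
    push_cast at *
    have hn : (0 : ℝ) ≤ n := Nat.cast_nonneg n
    rw [abs_of_nonneg hn] at h1 ih
    rw [abs_of_nonneg (show (0 : ℝ) ≤ n + 1 by linarith)] at h2 ⊢
    nlinarith
  | pred n ih =>
    have h0 := midpointSum_add_one h (-(n : ℤ) - 1)
    rw [sub_add_cancel] at h0
    have h1 := hh (-n)
    have h2 := hh (-n - 1)
    have h4 : midpointSum h (-(n : ℤ) - 1) =
        midpointSum h (-(n : ℤ)) + -h (-n) + -h (-n - 1) := by linarith
    have h3 := abs_add_three (midpointSum h (-(n : ℤ))) (-h (-n)) (-h (-n - 1))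
    rw [h4]
    rw [abs_neg, abs_neg] at h3
    push_cast at *
    have hn : (0 : ℝ) ≤ n := Nat.cast_nonneg n
    rw [abs_neg, abs_of_nonneg hn] at h1 ih
    rw [show -(n : ℝ) - 1 = -(n + 1) by ring, abs_neg,
      abs_of_nonneg (show (0 : ℝ) ≤ n + 1 by linarith)] at h2 ⊢
    nlinarith

/-- Functions on `ℤ` of order `o(|y|)` at infinity. -/
def IsSublinear (h : ℤ → ℝ) : Prop :=
  ∀ ε > 0, ∃ C, 0 ≤ C ∧ ∀ y, |h y| ≤ ε * |(y : ℝ)| + C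

/-- Functions on `ℤ` of order `o(y ^ 2)` at infinity. -/
def IsSubquadratic (g : ℤ → ℝ) : Prop :=
  ∀ ε > 0, ∃ C, 0 ≤ C ∧ ∀ y, |g y| ≤ ε * (y : ℝ) ^ 2 + C

lemma IsSubquadratic.of_le_mul {g : ℤ → ℝ} {B : ℝ} (hB : 0 < B)
    (hg : ∀ ε > 0, ∃ C, 0 ≤ C ∧ ∀ y, |g y| ≤ B * |(y : ℝ)| * (ε * |(y : ℝ)| + C)) :
    IsSubquadratic g := by
  intro ε hε
  obtain ⟨C, hC, h⟩ := hg (ε / (2 * B)) (by positivity)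
  refine ⟨(B * C) ^ 2 / (2 * ε), by positivity, fun y => (h y).trans ?_⟩
  rw [← sq_abs (y : ℝ)]
  set z := |(y : ℝ)|
  have h1 : B * z * (ε / (2 * B) * z + C) = ε / 2 * z ^ 2 + B * C * z := by field_simp
  have h2 : ε * z ^ 2 + (B * C) ^ 2 / (2 * ε) - (ε / 2 * z ^ 2 + B * C * z) =
      (ε * z - B * C) ^ 2 / (2 * ε) := by field_simp; ring
  have h3 : 0 ≤ (ε * z - B * C) ^ 2 / (2 * ε) := by positivity
  linarith

lemma IsSublinear.midpointSum {h : ℤ → ℝ} (hh : IsSublinear h) :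
    IsSubquadratic (midpointSum h) := by
  refine IsSubquadratic.of_le_mul two_pos fun ε hε => ?_
  obtain ⟨C, hC, h⟩ := hh ε hε
  exact ⟨C, hC, abs_midpointSum_le hε.le h⟩

lemma IsSublinear.mul_self {h : ℤ → ℝ} (hh : IsSublinear h) :
    IsSubquadratic (fun y => h y * y) := by
  refine IsSubquadratic.of_le_mul one_pos fun ε hε => ?_
  obtain ⟨C, hC, h⟩ := hh ε hε
  refine ⟨C, hC, fun y => ?_⟩
  rw [abs_mul, one_mul, mul_comm]
  exact mul_le_mul_of_nonneg_left (h y) (abs_nonneg _)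

lemma IsSublinear.sq {h : ℤ → ℝ} (hh : IsSublinear h) : IsSubquadratic (fun y => h y ^ 2) := by
  intro ε hε
  obtain ⟨C, hC, h⟩ := hh (√(ε / 2)) (by positivity)
  refine ⟨2 * C ^ 2, by positivity, fun y => ?_⟩
  rw [abs_pow]
  have h1 := pow_le_pow_left₀ (abs_nonneg _) (h y) 2
  have h2 : √(ε / 2) ^ 2 = ε / 2 := Real.sq_sqrt (by positivity)
  have h3 : (√(ε / 2) * |(y : ℝ)|) ^ 2 = ε / 2 * (y : ℝ) ^ 2 := by rw [mul_pow, h2, sq_abs]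
  nlinarith [sq_nonneg (√(ε / 2) * |(y : ℝ)| - C)]

/-- The time of the `n`-th collision of a walk moving at unit speed between the points `ω y`. -/
def collisionTime {Ω : Type*} (ω : ℤ → ℝ) (S : ℕ → Ω → ℤ) (n : ℕ) (x : Ω) : ℝ :=
  ∑ k ∈ Finset.range n, |ω (S (k + 1) x) - ω (S k x)|

namespace IsReinforcedWalk

variable {Ω : Type*} [mΩ : MeasurableSpace Ω] {μ : Measure Ω}
  {ℱ : Filtration ℕ mΩ} {a : ℝ} {S : ℕ → Ω → ℤ}

lemma collisionTime_bounded (hS : IsReinforcedWalk μ ℱ a S) (ω : ℤ → ℝ) (n : ℕ) :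
    IsBoundedMeasurable (ℱ n) (collisionTime ω S n) := by
  refine IsBoundedMeasurable.sum _ fun k hk => ?_
  have hk : k + 1 ≤ n := Finset.mem_range.1 hk
  exact (((hS.comp ω (k + 1)).mono (ℱ.mono hk)).sub
    ((hS.comp ω k).mono (ℱ.mono (by omega)))).abs

/-- A discrete Stratonovich formula for the collision times. -/
lemma collisionTime_sub_eq (hS : IsReinforcedWalk μ ℱ a S) {ω : ℤ → ℝ} (hω : Monotone ω)
    (ℓ : ℝ) (n : ℕ) (x : Ω) :
    collisionTime ω S n x - ℓ * n = midpointSum (fun y => ω y - ℓ * y) (S n x) -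
      2 * ∑ k ∈ Finset.range n,
        (ω (S k x) - ℓ * S k x) * ((S (k + 1) x : ℝ) - S k x) := by
  induction n with
  | zero => simp [collisionTime, hS.zero, midpointSum_zero]
  | succ n ih =>
    rw [Finset.sum_range_succ]
    have hT : collisionTime ω S (n + 1) x =
      collisionTime ω S n x + |ω (S (n + 1) x) - ω (S n x)| := Finset.sum_range_succ _ _
    rw [hT]
    push_cast
    rcases hS.step n x with h | h
    · have h1 : S (n + 1) x = S n x + 1 := by linarith
      have h2 := midpointSum_add_one (fun y => ω y - ℓ * y) (S n x)
      have h3 := hω (show S n x ≤ S n x + 1 by linarith)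
      rw [h1, abs_of_nonneg (by linarith), h2]
      push_cast
      linarith
    · have h1 : S n x = S (n + 1) x + 1 := by linarith
      have h2 := midpointSum_add_one (fun y => ω y - ℓ * y) (S (n + 1) x)
      have h3 := hω (show S (n + 1) x ≤ S (n + 1) x + 1 by linarith)
      rw [h1] at ih ⊢
      rw [abs_of_nonpos (by linarith)]
      rw [h2] at ih
      push_cast at *
      linarith

variable [IsProbabilityMeasure μ]

lemma tendsto_integral_abs_div (hS : IsReinforcedWalk μ ℱ a S) (ha : a < 1 / 2) {g : ℤ → ℝ}
    (hg : IsSubquadratic g) :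
    Tendsto (fun n : ℕ => (∫ x, |g (S n x)| ∂μ) / n) atTop (𝓝 0) := by
  obtain ⟨K, hK, hKs⟩ := hS.exists_integral_sq_le ha
  rw [Metric.tendsto_atTop]
  intro η hη
  obtain ⟨C, hC, hgC⟩ := hg (η / (2 * K)) (by positivity)
  obtain ⟨N, hN⟩ := eventually_atTop.1 ((tendsto_const_div_atTop_nhds_zero_nat C).eventually_lt_const
    (show (0 : ℝ) < η / 2 by positivity))
  refine ⟨N + 1, fun n hn => ?_⟩
  have hn0 : (0 : ℝ) < n := by exact_mod_cast (show 0 < n by omega)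
  have h0 : 0 ≤ ∫ x, |g (S n x)| ∂μ := integral_nonneg fun x => abs_nonneg _
  rw [Real.dist_eq, sub_zero, abs_of_nonneg (by positivity)]
  have bq := (((hS.cast n).pow 2).const_mul (η / (2 * K))).add (IsBoundedMeasurable.const C)
  have h1 : ∫ x, |g (S n x)| ∂μ ≤ η / (2 * K) * (K * n) + C := by
    refine (integral_mono ((hS.comp g n).abs.integrable (ℱ.le n)) (bq.integrable (ℱ.le n))
      (fun x => hgC (S n x))).trans ?_
    rw [integral_add ((((hS.cast n).pow 2).const_mul _).integrable (ℱ.le n)) (integrable_const _),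
      integral_const_mul]
    simp only [integral_const, probReal_univ, one_smul]
    gcongr
    exact hKs n
  calc _ ≤ (η / (2 * K) * (K * n) + C) / n := by gcongr
    _ = η / 2 + C / n := by field_simp
    _ < η := by have := hN n (by omega); linarith

/-- Law of large numbers in `L¹` for the collision times. -/
lemma tendsto_integral_abs_collisionTime_sub (hS : IsReinforcedWalk μ ℱ a S) (ha1 : |a| ≤ 1)
    (ha : a < 1 / 2) {ω : ℤ → ℝ} (hω : Monotone ω) (hω0 : ω 0 = 0) {ℓ : ℝ}
    (hsub : IsSublinear fun y => ω y - ℓ * y) :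
    Tendsto (fun n : ℕ => (∫ x, |collisionTime ω S n x - ℓ * n| ∂μ) / n) atTop (𝓝 0) := by
  set h : ℤ → ℝ := fun y => ω y - ℓ * y with hh
  have l1 := hS.tendsto_integral_abs_div ha hsub.midpointSum
  have l2 := (hS.tendsto_integral_abs_div ha hsub.sq).cesaro
  have l3 := (hS.tendsto_integral_abs_div ha hsub.mul_self).cesaro
  have l2' := (Real.continuous_sqrt.tendsto _).comp l2
  rw [Real.sqrt_zero] at l2'
  have hlim := (l1.add (l2'.const_mul 2)).add (l3.const_mul 2)
  simp only [mul_zero, add_zero] at hlim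
  refine squeeze_zero (fun n => div_nonneg (integral_nonneg fun x => abs_nonneg _) (by positivity))
    (fun n => ?_) hlim
  rcases Nat.eq_zero_or_pos n with rfl | hn
  · simp
  have hn0 : (0 : ℝ) < n := by exact_mod_cast hn
  set M : Ω → ℝ := fun x => ∑ k ∈ Finset.range n,
    h (S k x) * ((S (k + 1) x : ℝ) - S k x - a * S k x / k) with hM
  have bM : IsBoundedMeasurable (ℱ n) M := by
    refine IsBoundedMeasurable.sum _ fun k hk => ?_
    have hk : k + 1 ≤ n := Finset.mem_range.1 hk
    exact ((hS.comp h k).mono (ℱ.mono (by omega))).mul (((hS.increment k).mono (ℱ.mono hk)).sub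
      ((hS.drift_bounded k).mono (ℱ.mono (by omega))))
  have bR : ∀ k ∈ Finset.range n, IsBoundedMeasurable (ℱ n) (fun x => |h (S k x) * S k x| / k) :=
    fun k hk => (hS.comp (fun y => |h y * y| / k) k).mono (ℱ.mono (Finset.mem_range.1 hk).le)
  have bH := hS.comp (_root_.midpointSum h) n
  have hpt : ∀ x, |collisionTime ω S n x - ℓ * n| ≤ |_root_.midpointSum h (S n x)| + 2 * |M x| +
      2 * ∑ k ∈ Finset.range n, |h (S k x) * S k x| / k := by
    intro x
    rw [hS.collisionTime_sub_eq hω]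
    have h1 : ∑ k ∈ Finset.range n, (ω (S k x) - ℓ * S k x) * ((S (k + 1) x : ℝ) - S k x) =
        M x + ∑ k ∈ Finset.range n, a * (h (S k x) * S k x / k) := by
      rw [hM, ← Finset.sum_add_distrib]
      refine Finset.sum_congr rfl fun k _ => ?_
      simp only [hh]; ring
    have h2 : |∑ k ∈ Finset.range n, a * (h (S k x) * S k x / k)| ≤
        ∑ k ∈ Finset.range n, |h (S k x) * S k x| / k := by
      refine (Finset.abs_sum_le_sum_abs _ _).trans (Finset.sum_le_sum fun k _ => ?_)
      rw [abs_mul, abs_div, Nat.abs_cast]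
      exact mul_le_of_le_one_left (by positivity) ha1
    rw [h1]
    refine (abs_sub _ _).trans ?_
    rw [abs_mul, abs_two]
    have h3 := abs_add_le (M x) (∑ k ∈ Finset.range n, a * (h (S k x) * S k x / k))
    linarith
  have hMint : ∫ x, |M x| ∂μ ≤ n * √((n : ℝ)⁻¹ * ∑ k ∈ Finset.range n,
      (∫ x, |h (S k x) ^ 2| ∂μ) / k) := by
    refine (bM.integral_abs_le_sqrt (ℱ.le n) μ).trans ?_
    rw [Real.sqrt_le_left (by positivity), mul_pow, Real.sq_sqrt]
    swap
    · refine mul_nonneg (by positivity) (Finset.sum_nonneg fun k _ => ?_)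
      exact div_nonneg (integral_nonneg fun x => abs_nonneg _) (by positivity)
    refine (hS.integral_transform_sq_le (fun k => hS.comp h k) n).trans ?_
    rw [show (n : ℝ) ^ 2 * ((n : ℝ)⁻¹ * ∑ k ∈ Finset.range n, (∫ x, |h (S k x) ^ 2| ∂μ) / k) =
      n * ∑ k ∈ Finset.range n, (∫ x, |h (S k x) ^ 2| ∂μ) / k by field_simp, Finset.mul_sum]
    refine Finset.sum_le_sum fun k hk => ?_
    simp only [abs_pow, sq_abs]
    rcases Nat.eq_zero_or_pos k with rfl | hk0
    · simp [hS.zero, hh, hω0]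
    have hk0' : (0 : ℝ) < k := by exact_mod_cast hk0
    have hkn : (k : ℝ) ≤ n := by exact_mod_cast (Finset.mem_range.1 hk).le
    have h0 : 0 ≤ ∫ x, h (S k x) ^ 2 ∂μ := integral_nonneg fun x => sq_nonneg _
    rw [mul_div_assoc', le_div_iff₀ hk0']
    nlinarith
  have bA := bH.abs.add (bM.abs.const_mul 2)
  have bB := (IsBoundedMeasurable.sum _ bR).const_mul 2
  have hint : ∫ x, |collisionTime ω S n x - ℓ * n| ∂μ ≤ ∫ x, |_root_.midpointSum h (S n x)| ∂μ +
      2 * ∫ x, |M x| ∂μ + 2 * ∑ k ∈ Finset.range n, (∫ x, |h (S k x) * S k x| ∂μ) / k := by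
    refine (integral_mono (((hS.collisionTime_bounded ω n).sub
      (IsBoundedMeasurable.const _)).abs.integrable (ℱ.le n))
      ((bA.add bB).integrable (ℱ.le n)) hpt).trans (le_of_eq ?_)
    rw [integral_add (bA.integrable (ℱ.le n)) (bB.integrable (ℱ.le n)),
      integral_add (bH.abs.integrable (ℱ.le n)) ((bM.abs.const_mul 2).integrable (ℱ.le n)),
      integral_const_mul, integral_const_mul,
      integral_finsetSum _ fun k hk => (bR k hk).integrable (ℱ.le n)]
    simp only [integral_div]
  rw [div_le_iff₀ hn0]
  refine hint.trans ?_
  simp only [Function.comp]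
  set s2 := √((n : ℝ)⁻¹ * ∑ k ∈ Finset.range n, (∫ x, |h (S k x) ^ 2| ∂μ) / k)
  rw [add_mul, add_mul, div_mul_cancel₀ _ hn0.ne']
  have h3 : 2 * ((n : ℝ)⁻¹ * ∑ k ∈ Finset.range n, (∫ x, |h (S k x) * S k x| ∂μ) / k) * n =
    2 * ∑ k ∈ Finset.range n, (∫ x, |h (S k x) * S k x| ∂μ) / k := by field_simp
  rw [h3]
  linarith

end IsReinforcedWalk

lemma isSublinear_sub_mul {ω : ℤ → ℝ} {ℓ : ℝ}
    (h1 : Tendsto (fun n : ℕ => ω n / n) atTop (𝓝 ℓ))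
    (h2 : Tendsto (fun n : ℕ => ω (-n) / n) atTop (𝓝 (-ℓ))) :
    IsSublinear fun y => ω y - ℓ * y := by
  intro ε hε
  obtain ⟨N₁, hN₁⟩ := Metric.tendsto_atTop.1 h1 ε hε
  obtain ⟨N₂, hN₂⟩ := Metric.tendsto_atTop.1 h2 ε hε
  set N := N₁ + N₂ + 1
  refine ⟨∑ y ∈ Finset.Icc (-(N : ℤ)) N, |ω y - ℓ * y|,
    Finset.sum_nonneg fun _ _ => abs_nonneg _, fun y => ?_⟩
  by_cases hy : y ∈ Finset.Icc (-(N : ℤ)) N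
  · have := Finset.single_le_sum (f := fun y : ℤ => |ω y - ℓ * y|) (fun _ _ => abs_nonneg _) hy
    have h3 : 0 ≤ ε * |(y : ℝ)| := by positivity
    linarith
  refine le_add_of_le_of_nonneg ?_ (Finset.sum_nonneg fun _ _ => abs_nonneg _)
  rw [Finset.mem_Icc] at hy
  obtain ⟨n, rfl | rfl⟩ := y.eq_nat_or_neg
  · have hn0 : (0 : ℝ) < n := by exact_mod_cast (show 0 < n by omega)
    have h := hN₁ n (by omega)
    rw [Real.dist_eq, div_sub' hn0.ne', abs_div, Nat.abs_cast, div_lt_iff₀ hn0] at h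
    beta_reduce
    rw [Int.cast_natCast, Nat.abs_cast, mul_comm ℓ]
    exact h.le
  · have hn0 : (0 : ℝ) < n := by exact_mod_cast (show 0 < n by omega)
    have h := hN₂ n (by omega)
    rw [Real.dist_eq, div_sub' hn0.ne', abs_div, Nat.abs_cast, div_lt_iff₀ hn0] at h
    beta_reduce
    rw [Int.cast_neg, Int.cast_natCast, abs_neg, Nat.abs_cast, mul_neg, ← neg_mul, mul_comm (-ℓ)]
    exact h.le

lemma continuous_measureReal_Iic (ν : Measure ℝ) [IsProbabilityMeasure ν] [NullSingletonClass ν] :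
    Continuous fun x => ν.real (Iic x) := by
  have h : (fun x => ν.real (Iic x)) = cdf ν := funext fun x => (cdf_eq_real ν x).symm
  rw [h, continuous_iff_continuousAt]
  intro x
  rw [(monotone_cdf ν).continuousAt_iff_leftLim_eq_rightLim, (cdf ν).rightLim_eq]
  have h1 : (cdf ν).measure {x} = 0 := by rw [measure_cdf]; exact measure_singleton x
  rw [StieltjesFunction.measure_singleton, ENNReal.ofReal_eq_zero] at h1
  exact le_antisymm ((monotone_cdf ν).leftLim_le le_rfl) (by linarith)

/-- Convergence of distribution functions to a continuous limit is stable under perturbations that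
vanish in probability. -/
lemma tendsto_measureReal_le_of_approx {Ω : Type*} [MeasurableSpace Ω] {μ : Measure Ω}
    [IsProbabilityMeasure μ] {Z : ℝ → Ω → ℝ} {Y : ℕ → Ω → ℝ} {m : ℝ → ℕ}
    (hm : Tendsto m atTop atTop) {F : ℝ → ℝ} (hF : Continuous F)
    (hY : ∀ x, Tendsto (fun n => μ.real {b | Y n b ≤ x}) atTop (𝓝 (F x)))
    (hZ : ∀ η > 0, Tendsto (fun t => μ.real {b | η < |Z t b - Y (m t) b|}) atTop (𝓝 0)) (x : ℝ) :
    Tendsto (fun t => μ.real {b | Z t b ≤ x}) atTop (𝓝 (F x)) := by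
  rw [Metric.tendsto_nhds]
  intro ε hε
  obtain ⟨η, hη, hFη⟩ := Metric.continuousAt_iff.1 (hF.continuousAt (x := x)) (ε / 3) (by positivity)
  have e1 := Metric.tendsto_nhds.1 ((hY (x + η / 2)).comp hm) (ε / 3) (by positivity)
  have e2 := Metric.tendsto_nhds.1 ((hY (x - η / 2)).comp hm) (ε / 3) (by positivity)
  have e3 := (hZ (η / 2) (by positivity)).eventually_lt_const (show 0 < ε / 3 by positivity)
  have f1 := hFη (x := x + η / 2) (by rw [Real.dist_eq, abs_lt]; constructor <;> linarith)
  have f2 := hFη (x := x - η / 2) (by rw [Real.dist_eq, abs_lt]; constructor <;> linarith)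
  filter_upwards [e1, e2, e3] with t h1 h2 h3
  have s1 : {b | Z t b ≤ x} ⊆
      {b | Y (m t) b ≤ x + η / 2} ∪ {b | η / 2 < |Z t b - Y (m t) b|} := by
    intro b (hb : Z t b ≤ x)
    by_contra hc
    simp only [mem_union, mem_ofPred_eq, not_or, not_le, not_lt] at hc
    have := (abs_le.1 hc.2).1
    linarith [hc.1]
  have s2 : {b | Y (m t) b ≤ x - η / 2} ⊆
      {b | Z t b ≤ x} ∪ {b | η / 2 < |Z t b - Y (m t) b|} := by
    intro b (hb : Y (m t) b ≤ x - η / 2)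
    by_contra hc
    simp only [mem_union, mem_ofPred_eq, not_or, not_le, not_lt] at hc
    have := (abs_le.1 hc.2).2
    linarith [hc.1]
  have u1 := (measureReal_mono (μ := μ) s1).trans (measureReal_union_le _ _)
  have u2 := (measureReal_mono (μ := μ) s2).trans (measureReal_union_le _ _)
  simp only [Function.comp, Real.dist_eq, abs_lt] at *
  constructor <;> linarith [h1.1, h1.2, h2.1, h2.2, f1.1, f1.2, f2.1, f2.2]

/-- The filtration generated by the steps `V 1, V 2, …`. -/
def stepFiltration {Ω : Type*} [mΩ : MeasurableSpace Ω] (V : ℕ → Ω → ℤ)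
    (hV : ∀ n, Measurable (V n)) : Filtration ℕ mΩ where
  seq n := ⨆ k ∈ Set.Icc 1 n, MeasurableSpace.comap (V k) inferInstance
  mono' _ _ h := biSup_mono fun _ hk => ⟨hk.1, hk.2.trans h⟩
  le' _ := iSup₂_le fun k _ => (hV k).comap_le

lemma isReinforcedWalk_of_condExp {Ω : Type*} [MeasurableSpace Ω] {μ : Measure Ω}
    [IsProbabilityMeasure μ] {p : ℝ} {V : ℕ → Ω → ℤ} (hVmeas : ∀ n, Measurable (V n))
    (hVval : ∀ n a, 1 ≤ n → V n a = 1 ∨ V n a = -1) (hV1 : μ {a | V 1 a = 1} = 1 / 2)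
    {S : ℕ → Ω → ℤ} (hS : ∀ n a, S n a = ∑ k ∈ Finset.range n, V (k + 1) a)
    (hcond : ∀ n : ℕ, 1 ≤ n →
      μ[({a | V (n + 1) a = 1}).indicator (fun _ => (1 : ℝ)) |
          ⨆ k ∈ Set.Icc 1 n, MeasurableSpace.comap (V k) inferInstance]
        =ᵐ[μ] fun a => 1 / 2 + (2 * p - 1) * (S n a : ℝ) / (2 * n)) :
    IsReinforcedWalk μ (stepFiltration V hVmeas) (2 * p - 1) S := by
  have hsucc : ∀ n x, S (n + 1) x - S n x = V (n + 1) x := fun n x => by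
    rw [hS, hS, Finset.sum_range_succ, add_sub_cancel_left]
  refine ⟨fun x => by simp [hS], fun n x => ?_, fun n => ?_, fun n f hf => ?_⟩
  · rw [hsucc]; exact hVval _ _ (by omega)
  · have h : S n = fun x => ∑ k ∈ Finset.range n, V (k + 1) x := funext (hS n)
    rw [h]
    refine Finset.measurable_fun_sum (m := stepFiltration V hVmeas n) _ fun k hk => ?_
    have hk : k + 1 ≤ n := Finset.mem_range.1 hk
    rw [measurable_iff_comap_le]
    exact le_iSup₂_of_le (f := fun k (_ : k ∈ Set.Icc 1 n) =>
      MeasurableSpace.comap (V k) inferInstance) (k + 1) ⟨by omega, hk⟩ le_rfl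
  · set ℱ := stepFiltration V hVmeas
    set g : Ω → ℝ := ({a | V (n + 1) a = 1}).indicator fun _ => (1 : ℝ) with hg
    have hms : MeasurableSet {a | V (n + 1) a = 1} :=
      hVmeas (n + 1) (measurableSet_singleton (1 : ℤ))
    have hgm : Integrable g μ := (integrable_const (1 : ℝ)).indicator hms
    have hce : μ[g | ℱ n] =ᵐ[μ] fun a => 1 / 2 + (2 * p - 1) * (S n a : ℝ) / (2 * n) := by
      rcases Nat.eq_zero_or_pos n with rfl | hn
      · have hbot : (ℱ 0 : MeasurableSpace Ω) = ⊥ := by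
          change (⨆ k ∈ Set.Icc 1 0, MeasurableSpace.comap (V k) inferInstance) = ⊥
          simp
        rw [hbot, condExp_bot, hg, integral_indicator_const _ hms]
        simp [Measure.real, hV1]
      · exact hcond n hn
    obtain ⟨C, hC⟩ := hf.2
    have hfg : Integrable (fun x => f x * g x) μ :=
      hgm.bdd_mul (hf.integrable (ℱ.le n)).aestronglyMeasurable (Eventually.of_forall hC)
    have hpull := condExp_mul_of_stronglyMeasurable_left hf.1.stronglyMeasurable hfg hgm
    have hint : ∫ x, f x * g x ∂μ =
        ∫ x, f x * (1 / 2 + (2 * p - 1) * (S n x : ℝ) / (2 * n)) ∂μ := by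
      have h1 := integral_condExp (μ := μ) (f := f * g) (ℱ.le n)
      refine h1.symm.trans (integral_congr_ae ?_)
      filter_upwards [hpull, hce] with x hx1 hx2
      rw [hx1, Pi.mul_apply, hx2]
    have hVg : ∀ x, f x * ((S (n + 1) x : ℝ) - S n x) = 2 * (f x * g x) - f x := by
      intro x
      rw [← Int.cast_sub, hsucc]
      rcases hVval (n + 1) x (by omega) with h | h
      · simp [hg, h]; ring
      · simp [hg, h]
    have hR : ∀ x, f x * ((2 * p - 1) * S n x / n) =
        2 * (f x * (1 / 2 + (2 * p - 1) * (S n x : ℝ) / (2 * n))) - f x := by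
      intro x
      rw [mul_comm (2 : ℝ) (n : ℝ), ← div_div]; ring
    have hfR : Integrable (fun x => f x * (1 / 2 + (2 * p - 1) * (S n x : ℝ) / (2 * n))) μ := by
      refine (integrable_condExp (m := ℱ n) (f := f * g)).congr ?_
      filter_upwards [hpull, hce] with x hx1 hx2
      rw [hx1, Pi.mul_apply, hx2]
    simp only [hVg, hR]
    rw [integral_sub (hfg.const_mul 2) (hf.integrable (ℱ.le n)),
      integral_sub (hfR.const_mul 2) (hf.integrable (ℱ.le n)), integral_const_mul,
      integral_const_mul, hint]

lemma collisionTime_mono {Ω : Type*} (ω : ℤ → ℝ) (S : ℕ → Ω → ℤ) (x : Ω) :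
    Monotone fun n => collisionTime ω S n x :=
  monotone_nat_of_le_succ fun n => by
    simp only [collisionTime, Finset.sum_range_succ]
    exact le_add_of_nonneg_right (abs_nonneg _)

/-- The difference of the indicators of `T k ≤ t` and of `k < m`, for `k ≥ m₁`. -/
noncomputable def crossingWeight {Ω : Type*} (ω : ℤ → ℝ) (S : ℕ → Ω → ℤ) (t : ℝ) (m₁ m k : ℕ)
    (x : Ω) : ℝ :=
  if m₁ ≤ k then (Iic t).indicator 1 (collisionTime ω S k x) - (Iio m).indicator 1 k else 0

lemma abs_crossingWeight_le {Ω : Type*} (ω : ℤ → ℝ) (S : ℕ → Ω → ℤ) (t : ℝ) (m₁ m k : ℕ)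
    (x : Ω) : |crossingWeight ω S t m₁ m k x| ≤ 1 := by
  simp only [crossingWeight, indicator_apply, Pi.one_apply]
  split_ifs <;> norm_num

/-- The number of collisions up to time `t` is located once `T m₁ ≤ t < T m₂`. -/
lemma exists_collisionTime_le_lt {Ω : Type*} (ω : ℤ → ℝ) {S : ℕ → Ω → ℤ} {t : ℝ} {m₁ m m₂ : ℕ}
    (h₁ : m₁ ≤ m) (h₂ : m ≤ m₂) {x : Ω} (ht₁ : collisionTime ω S m₁ x ≤ t)
    (ht₂ : t < collisionTime ω S m₂ x) :
    ∃ j, collisionTime ω S j x ≤ t ∧ t < collisionTime ω S (j + 1) x ∧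
      (S (j + 1) x : ℝ) = S m x + ∑ k ∈ Finset.range m₂,
        crossingWeight ω S t m₁ m k x * ((S (k + 1) x : ℝ) - S k x) := by
  classical
  have hT := collisionTime_mono ω S x
  have hex : ∃ n, t < collisionTime ω S n x := ⟨m₂, ht₂⟩
  set i := Nat.find hex with hi
  have hlt : ∀ k, collisionTime ω S k x ≤ t ↔ k < i := fun k => by
    rw [← not_iff_not, not_le, not_lt]
    exact ⟨fun h => Nat.find_min' hex h, fun h => (Nat.find_spec hex).trans_le (hT h)⟩
  have hm₁i : m₁ < i := (hlt m₁).1 ht₁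
  have him₂ : i ≤ m₂ := Nat.find_min' hex ht₂
  refine ⟨i - 1, (hlt _).2 (by omega), ?_, ?_⟩
  · rw [show i - 1 + 1 = i by omega]
    exact Nat.find_spec hex
  · rw [show i - 1 + 1 = i by omega]
    have hw : ∀ k, crossingWeight ω S t m₁ m k x * ((S (k + 1) x : ℝ) - S k x) =
        (if k < i then ((S (k + 1) x : ℝ) - S k x) else 0) -
          (if k < m then ((S (k + 1) x : ℝ) - S k x) else 0) := by
      intro k
      simp only [crossingWeight, indicator_apply, mem_Iic, mem_Iio, hlt, Pi.one_apply]
      split_ifs <;> first | omega | simp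
    have hsum : ∀ n ≤ m₂, ∑ k ∈ Finset.range m₂, (if k < n then ((S (k + 1) x : ℝ) - S k x) else 0)
        = S n x - S 0 x := by
      intro n hn
      rw [← Finset.sum_range_sub (fun k => (S k x : ℝ)), ← Finset.sum_filter]
      congr 1
      ext k
      simp only [Finset.mem_filter, Finset.mem_range]
      omega
    simp only [hw, Finset.sum_sub_distrib]
    rw [hsum i him₂, hsum m h₂]
    ring

namespace IsReinforcedWalk

variable {Ω : Type*} [mΩ : MeasurableSpace Ω] {μ : Measure Ω}
  {ℱ : Filtration ℕ mΩ} {a : ℝ} {S : ℕ → Ω → ℤ}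

lemma crossingWeight_bounded (hS : IsReinforcedWalk μ ℱ a S) (ω : ℤ → ℝ) (t : ℝ) (m₁ m k : ℕ) :
    IsBoundedMeasurable (ℱ k) (crossingWeight ω S t m₁ m k) := by
  refine ⟨?_, 1, abs_crossingWeight_le ω S t m₁ m k⟩
  unfold crossingWeight
  split_ifs
  · have h : Measurable ((Iic t).indicator (1 : ℝ → ℝ)) := measurable_one.indicator measurableSet_Iic
    exact (h.comp (hS.collisionTime_bounded ω k).1).sub_const _
  · exact measurable_const

/-- A transform of the walk by weights supported in `[m₁, m₂)` is small in `L¹`. -/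
lemma integral_abs_transform_le [IsProbabilityMeasure μ] (hS : IsReinforcedWalk μ ℱ a S)
    (ha1 : |a| ≤ 1) {K : ℝ} (hK0 : 0 ≤ K) (hK : ∀ n : ℕ, ∫ x, (S n x : ℝ) ^ 2 ∂μ ≤ K * n)
    {c : ℕ → Ω → ℝ} (hc : ∀ k, IsBoundedMeasurable (ℱ k) (c k)) (hc1 : ∀ k x, |c k x| ≤ 1)
    {m₁ m₂ : ℕ} (hm₁ : 0 < m₁) (hc0 : ∀ k < m₁, ∀ x, c k x = 0) :
    ∫ x, |∑ k ∈ Finset.range m₂, c k x * ((S (k + 1) x : ℝ) - S k x)| ∂μ ≤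
      √(m₂ - m₁ : ℕ) + (m₂ - m₁ : ℕ) * (√K / √m₁) := by
  have hsupp : ∀ {u : ℕ → ℝ} {b : ℝ}, (∀ k < m₁, u k = 0) → (∀ k, m₁ ≤ k → u k ≤ b) →
      ∑ k ∈ Finset.range m₂, u k ≤ (m₂ - m₁ : ℕ) * b := by
    intro u b h0 hb
    have h1 : ∑ k ∈ Finset.Ico m₁ m₂, u k = ∑ k ∈ Finset.range m₂, u k := by
      refine Finset.sum_subset (fun k hk => ?_) (fun k hk hk' => h0 k ?_)
      · rw [Finset.mem_Ico] at hk; exact Finset.mem_range.2 hk.2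
      · rw [Finset.mem_range] at hk; rw [Finset.mem_Ico] at hk'; omega
    rw [← h1]
    refine (Finset.sum_le_card_nsmul _ _ b fun k hk => hb k (Finset.mem_Ico.1 hk).1).trans ?_
    rw [Nat.card_Ico, nsmul_eq_mul]
  set M : Ω → ℝ := fun x => ∑ k ∈ Finset.range m₂,
    c k x * ((S (k + 1) x : ℝ) - S k x - a * S k x / k) with hM
  set R : Ω → ℝ := fun x => ∑ k ∈ Finset.range m₂, |c k x| * (|(S k x : ℝ)| / k) with hR
  have bM : IsBoundedMeasurable (ℱ m₂) M := by
    refine IsBoundedMeasurable.sum _ fun k hk => ?_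
    have hk : k + 1 ≤ m₂ := Finset.mem_range.1 hk
    exact ((hc k).mono (ℱ.mono (by omega))).mul (((hS.increment k).mono (ℱ.mono hk)).sub
      ((hS.drift_bounded k).mono (ℱ.mono (by omega))))
  have bRk : ∀ k, IsBoundedMeasurable (ℱ k) (fun x => |c k x| * (|(S k x : ℝ)| / k)) := fun k =>
    (hc k).abs.mul (hS.comp (fun y => |(y : ℝ)| / k) k)
  have bR : IsBoundedMeasurable (ℱ m₂) R := IsBoundedMeasurable.sum _ fun k hk =>
    (bRk k).mono (ℱ.mono (Finset.mem_range.1 hk).le)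
  have bD : IsBoundedMeasurable (ℱ m₂)
      (fun x => ∑ k ∈ Finset.range m₂, c k x * ((S (k + 1) x : ℝ) - S k x)) := by
    refine IsBoundedMeasurable.sum _ fun k hk => ?_
    have hk : k + 1 ≤ m₂ := Finset.mem_range.1 hk
    exact ((hc k).mono (ℱ.mono (by omega))).mul ((hS.increment k).mono (ℱ.mono hk))
  have hpt : ∀ x, |∑ k ∈ Finset.range m₂, c k x * ((S (k + 1) x : ℝ) - S k x)| ≤ |M x| + R x := by
    intro x
    have h1 : ∑ k ∈ Finset.range m₂, c k x * ((S (k + 1) x : ℝ) - S k x) =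
        M x + ∑ k ∈ Finset.range m₂, c k x * (a * S k x / k) := by
      rw [hM, ← Finset.sum_add_distrib]
      exact Finset.sum_congr rfl fun k _ => by ring
    rw [h1]
    refine (abs_add_le _ _).trans (add_le_add_right ?_ _)
    refine (Finset.abs_sum_le_sum_abs _ _).trans (Finset.sum_le_sum fun k _ => ?_)
    rw [abs_mul, abs_div, abs_mul, Nat.abs_cast]
    gcongr
    exact mul_le_of_le_one_left (abs_nonneg _) ha1
  refine (integral_mono (bD.abs.integrable (ℱ.le m₂))
    ((bM.abs.add bR).integrable (ℱ.le m₂)) hpt).trans ?_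
  rw [integral_add (bM.abs.integrable (ℱ.le m₂)) (bR.integrable (ℱ.le m₂))]
  refine add_le_add ?_ ?_
  · refine (bM.integral_abs_le_sqrt (ℱ.le m₂) μ).trans (Real.sqrt_le_sqrt ?_)
    refine (hS.integral_transform_sq_le hc m₂).trans ?_
    rw [← mul_one ((m₂ - m₁ : ℕ) : ℝ)]
    refine hsupp (fun k hk => by simp [hc0 k hk]) (fun k _ => ?_)
    refine (integral_mono (((hc k).pow 2).integrable (ℱ.le k)) (integrable_const (1 : ℝ))
      fun x => ?_).trans (by simp)
    exact (sq_le_one_iff_abs_le_one _).2 (hc1 k x)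
  · rw [hR, integral_finsetSum _ fun k _ => (bRk k).integrable (ℱ.le k)]
    refine hsupp (fun k hk => by simp [hc0 k hk]) (fun k hk => ?_)
    have hk0 : (0 : ℝ) < k := by exact_mod_cast hm₁.trans_le hk
    have hm0 : (0 : ℝ) < m₁ := by exact_mod_cast hm₁
    calc ∫ x, |c k x| * (|(S k x : ℝ)| / k) ∂μ ≤ ∫ x, |(S k x : ℝ)| / k ∂μ := by
          refine integral_mono ((bRk k).integrable (ℱ.le k))
            ((hS.comp (fun y => |(y : ℝ)| / k) k).integrable (ℱ.le k)) fun x => ?_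
          exact mul_le_of_le_one_left (by positivity) (hc1 k x)
      _ = (∫ x, |(S k x : ℝ)| ∂μ) / k := integral_div _ _
      _ ≤ √(K * k) / k := by gcongr; exact hS.integral_abs_le hK k
      _ = √K / √k := by
          rw [Real.sqrt_mul hK0, mul_div_assoc, Real.sqrt_div_self', mul_one_div]
      _ ≤ √K / √m₁ := by gcongr

end IsReinforcedWalk

lemma abs_mul_sub_sqrt_mul_le {ℓ t s : ℝ} {m : ℕ} (hℓ : 0 < ℓ) (hm : 0 < m) (ht₁ : ℓ * m ≤ t)
    (ht₂ : t < ℓ * (m + 1)) (hs : |s| ≤ m) : |ℓ * s - √t * (√ℓ * (s / √m))| ≤ ℓ := by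
  have hm0 : (0 : ℝ) < m := by exact_mod_cast hm
  have hsm : 0 < √(m : ℝ) := Real.sqrt_pos.2 hm0
  have hsq : √(m : ℝ) * √m = m := Real.mul_self_sqrt hm0.le
  have hl : √ℓ * √ℓ = ℓ := Real.mul_self_sqrt hℓ.le
  have h1 : √ℓ * √m ≤ √t := by
    rw [← Real.sqrt_mul hℓ.le]; exact Real.sqrt_le_sqrt ht₁
  have h2 : √t ≤ √ℓ * (√m + 1 / √m) := by
    rw [Real.sqrt_le_left (by positivity), mul_pow, sq, hl]
    refine ht₂.le.trans (mul_le_mul_of_nonneg_left ?_ hℓ.le)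
    have h3 : (√(m : ℝ) + 1 / √m) ^ 2 = m + 2 + (1 / √m) ^ 2 := by
      rw [add_sq, sq, hsq]; field_simp
    have := sq_nonneg (1 / √(m : ℝ))
    linarith
  have h4 : ℓ * s - √t * (√ℓ * (s / √m)) = (√ℓ * √m - √t) * (√ℓ * s / √m) := by
    field_simp
    linear_combination -s * √m * hl
  have h5 : |√ℓ * √m - √t| ≤ √ℓ / √m := by
    rw [abs_sub_comm, abs_of_nonneg (by linarith)]
    have : √ℓ * (√m + 1 / √m) = √ℓ * √m + √ℓ / √m := by ring
    linarith
  have h6 : |√ℓ * s / √m| ≤ √ℓ * √m := by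
    rw [abs_div, abs_mul, abs_of_pos hsm, abs_of_nonneg (Real.sqrt_nonneg ℓ), div_le_iff₀ hsm,
      mul_assoc, hsq]
    gcongr
  rw [h4, abs_mul]
  calc _ ≤ √ℓ / √m * (√ℓ * √m) := by gcongr
    _ = ℓ := by field_simp; rw [Real.sq_sqrt hℓ.le]

namespace IsReinforcedWalk

variable {Ω : Type*} [mΩ : MeasurableSpace Ω] {μ : Measure Ω}
  {ℱ : Filtration ℕ mΩ} {a : ℝ} {S : ℕ → Ω → ℤ}

/-- Comparison of a trajectory through the points `ω (S n)` with `ℓ` times the walk, when the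
number of collisions up to time `t` lies between `m₁` and `m₂`. -/
lemma abs_sub_mul_le (hS : IsReinforcedWalk μ ℱ a S) {ω : ℤ → ℝ} {ℓ ε C : ℝ} (hℓ : 0 < ℓ)
    (hε : 0 ≤ ε) (hε1 : ε ≤ 1) (hh : ∀ y : ℤ, |ω y - ℓ * y| ≤ ε * |(y : ℝ)| + C)
    {z t : ℝ} {x : Ω} (hz : ∀ n, collisionTime ω S n x ≤ t → t < collisionTime ω S (n + 1) x →
      |z - ω (S n x)| ≤ t - collisionTime ω S n x) {m₁ m m₂ : ℕ}
    (h₁ : m₁ ≤ m) (h₂ : m ≤ m₂) (ht₁ : collisionTime ω S m₁ x ≤ t)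
    (ht₂ : t < collisionTime ω S m₂ x) :
    |z - ℓ * S m x| ≤ 2 * ℓ + 3 + 3 * C + (ℓ + 3) * |∑ k ∈ Finset.range m₂,
      crossingWeight ω S t m₁ m k x * ((S (k + 1) x : ℝ) - S k x)| + 3 * ε * |(S m x : ℝ)| := by
  obtain ⟨j, hj₁, hj₂, hj⟩ := exists_collisionTime_le_lt ω h₁ h₂ ht₁ ht₂
  set D := ∑ k ∈ Finset.range m₂, crossingWeight ω S t m₁ m k x * ((S (k + 1) x : ℝ) - S k x)
  have hzj := hz j hj₁ hj₂
  have hT : collisionTime ω S (j + 1) x =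
    collisionTime ω S j x + |ω (S (j + 1) x) - ω (S j x)| := Finset.sum_range_succ _ _
  have hstep : |(S (j + 1) x : ℝ) - S j x| = 1 := by
    rw [← Int.cast_sub]
    rcases hS.step j x with h | h <;> simp [h]
  have e1 := hh (S j x)
  have e2 := hh (S (j + 1) x)
  have n1 : |(S (j + 1) x : ℝ)| ≤ |(S m x : ℝ)| + |D| := by rw [hj]; exact abs_add_le _ _
  have n2 : |(S j x : ℝ)| ≤ |(S m x : ℝ)| + |D| + 1 := by
    have := abs_sub_abs_le_abs_sub (S j x : ℝ) (S (j + 1) x)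
    rw [abs_sub_comm, hstep] at this
    linarith
  have n3 : |(S j x : ℝ) - S m x| ≤ |D| + 1 := by
    have := abs_sub_le (S j x : ℝ) (S (j + 1) x) (S m x)
    rw [abs_sub_comm, abs_sub_comm (S j x : ℝ), hstep, hj, add_sub_cancel_left,
      abs_sub_comm] at this
    linarith
  have g1 : |ω (S (j + 1) x) - ω (S j x)| ≤ ℓ + |ω (S (j + 1) x) - ℓ * S (j + 1) x| +
      |ω (S j x) - ℓ * S j x| := by
    have h := abs_add_three (ℓ * ((S (j + 1) x : ℝ) - S j x)) (ω (S (j + 1) x) - ℓ * S (j + 1) x)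
      (-(ω (S j x) - ℓ * S j x))
    rw [abs_mul, hstep, abs_of_pos hℓ, abs_neg, mul_one] at h
    refine le_trans (le_of_eq ?_) h
    congr 1; ring
  have g2 : |z - ℓ * S m x| ≤ |z - ω (S j x)| + |ω (S j x) - ℓ * S j x| +
      ℓ * |(S j x : ℝ) - S m x| := by
    have h := abs_add_three (z - ω (S j x)) (ω (S j x) - ℓ * S j x) (ℓ * ((S j x : ℝ) - S m x))
    rw [abs_mul, abs_of_pos hℓ] at h
    refine le_trans (le_of_eq ?_) h
    congr 1; ring
  have k1 : ε * |(S j x : ℝ)| ≤ ε * |(S m x : ℝ)| + |D| + 1 := by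
    have := mul_le_mul_of_nonneg_left n2 hε
    nlinarith [abs_nonneg D]
  have k2 : ε * |(S (j + 1) x : ℝ)| ≤ ε * |(S m x : ℝ)| + |D| := by
    have := mul_le_mul_of_nonneg_left n1 hε
    nlinarith [abs_nonneg D]
  have k3 := mul_le_mul_of_nonneg_left n3 hℓ.le
  linarith

variable [IsProbabilityMeasure μ]

/-- Markov's inequality for the deviation of the collision times. -/
lemma measureReal_collisionTime_le (hS : IsReinforcedWalk μ ℱ a S) (ω : ℤ → ℝ) {ℓ c A : ℝ}
    {n : ℕ} (hn : 0 < n) (hc : 0 < c) (hA : n ≤ A * c) {s : Set Ω}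
    (hs : ∀ x ∈ s, c ≤ |collisionTime ω S n x - ℓ * n|) :
    μ.real s ≤ A * ((∫ x, |collisionTime ω S n x - ℓ * n| ∂μ) / n) := by
  have hn0 : (0 : ℝ) < n := by exact_mod_cast hn
  have b := ((hS.collisionTime_bounded ω n).sub (IsBoundedMeasurable.const (ℓ * n))).abs
  have h1 := mul_meas_ge_le_integral_of_nonneg (μ := μ) (Eventually.of_forall fun x => abs_nonneg _)
    (b.integrable (ℱ.le n)) c
  have h2 : μ.real s ≤ μ.real {x | c ≤ |collisionTime ω S n x - ℓ * n|} := measureReal_mono hs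
  have h0 : 0 ≤ μ.real s := measureReal_nonneg
  have hA0 : 0 ≤ A := by
    by_contra h
    nlinarith
  rw [← mul_div_assoc, le_div_iff₀ hn0]
  have h3 : c * μ.real s ≤ ∫ x, |collisionTime ω S n x - ℓ * n| ∂μ :=
    (mul_le_mul_of_nonneg_left h2 hc.le).trans h1
  nlinarith

lemma measureReal_lt_abs_sub_le (hS : IsReinforcedWalk μ ℱ a S) (ha1 : |a| ≤ 1) {K : ℝ}
    (hK0 : 0 ≤ K) (hK : ∀ n : ℕ, ∫ x, (S n x : ℝ) ^ 2 ∂μ ≤ K * n) {ω : ℤ → ℝ} {ℓ ε C : ℝ}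
    (hℓ : 0 < ℓ) (hε : 0 ≤ ε) (hε1 : ε ≤ 1) (hC : 0 ≤ C)
    (hh : ∀ y : ℤ, |ω y - ℓ * y| ≤ ε * |(y : ℝ)| + C) {z : Ω → ℝ} {t : ℝ}
    (hz : ∀ x n, collisionTime ω S n x ≤ t → t < collisionTime ω S (n + 1) x →
      |z x - ω (S n x)| ≤ t - collisionTime ω S n x) {r m : ℕ} (hr : 2 ≤ r) (hm : r ^ 2 ≤ m)
    (ht₁ : ℓ * m ≤ t) (ht₂ : t < ℓ * (m + 1)) {η : ℝ} (hη : 0 < η) :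
    μ.real {x | η < |z x / √t - √ℓ * (S m x / √m)|} ≤
      ((3 * ℓ + 3 + 3 * C) / √m + (ℓ + 3) * ((2 + 6 * √K) / r) + 3 * ε * √K) / (η * √ℓ) +
      (2 * r ^ 2 / ℓ * ((∫ x, |collisionTime ω S (m - m / r ^ 2) x - ℓ * (m - m / r ^ 2 : ℕ)| ∂μ) /
          (m - m / r ^ 2 : ℕ)) +
        6 * r ^ 2 / ℓ * ((∫ x, |collisionTime ω S (m + 1 + m / r ^ 2) x -
          ℓ * (m + 1 + m / r ^ 2 : ℕ)| ∂μ) / (m + 1 + m / r ^ 2 : ℕ))) := by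
  set d := m / r ^ 2 with hd
  have hr2 : 4 ≤ r ^ 2 := by nlinarith
  have hd1 : 1 ≤ d := (Nat.one_le_div_iff (by positivity)).2 hm
  have hdm : r ^ 2 * d ≤ m := Nat.mul_div_le m (r ^ 2)
  have hmd : m < r ^ 2 * (d + 1) := Nat.lt_mul_div_succ m (by positivity)
  have hmd' : m ≤ 2 * r ^ 2 * d := by nlinarith
  have hd4 : 4 * d ≤ m := by nlinarith
  clear_value d
  set m₁ := m - d with hm₁
  set m₂ := m + 1 + d with hm₂
  have hm0 : 0 < m := by omega
  have hmR : (0 : ℝ) < m := by exact_mod_cast hm0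
  have hsm : 0 < √(m : ℝ) := Real.sqrt_pos.2 hmR
  have hsl : 0 < √ℓ := Real.sqrt_pos.2 hℓ
  have hrR : (0 : ℝ) < r := by exact_mod_cast (show 0 < r by omega)
  have hr1 : (1 : ℝ) ≤ r := by exact_mod_cast (show 1 ≤ r by omega)
  have hdR : (0 : ℝ) < d := by exact_mod_cast hd1
  have hd1R : (1 : ℝ) ≤ d := by exact_mod_cast hd1
  have hdmR : (r : ℝ) ^ 2 * d ≤ m := by exact_mod_cast hdm
  have hmdR : (m : ℝ) ≤ 2 * r ^ 2 * d := by exact_mod_cast hmd'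
  have hm₁R : (m₁ : ℝ) = m - d := by rw [hm₁, Nat.cast_sub (by omega)]
  have hm₂R : (m₂ : ℝ) = m + 1 + d := by rw [hm₂]; push_cast; ring
  have ht0 : 0 < t := lt_of_lt_of_le (by positivity) ht₁
  have hst : √ℓ * √m ≤ √t := by
    rw [← Real.sqrt_mul hℓ.le]; exact Real.sqrt_le_sqrt ht₁
  set D : Ω → ℝ := fun x => ∑ k ∈ Finset.range m₂,
    crossingWeight ω S t m₁ m k x * ((S (k + 1) x : ℝ) - S k x) with hD
  set R : Ω → ℝ := fun x => 3 * ℓ + 3 + 3 * C + (ℓ + 3) * |D x| + 3 * ε * |(S m x : ℝ)| with hR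
  have bD : IsBoundedMeasurable (ℱ m₂) D := by
    refine IsBoundedMeasurable.sum _ fun k hk => ?_
    have hk : k + 1 ≤ m₂ := Finset.mem_range.1 hk
    exact ((hS.crossingWeight_bounded ω t m₁ m k).mono (ℱ.mono (by omega))).mul
      ((hS.increment k).mono (ℱ.mono hk))
  have bSm : IsBoundedMeasurable (ℱ m₂) (fun x => |(S m x : ℝ)|) :=
    (hS.cast m).abs.mono (ℱ.mono (by omega))
  have bR1 := (IsBoundedMeasurable.const (m := ℱ m₂) (3 * ℓ + 3 + 3 * C)).add
    (bD.abs.const_mul (ℓ + 3))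
  have bR : IsBoundedMeasurable (ℱ m₂) R := bR1.add (bSm.const_mul (3 * ε))
  have hsub : {x | η < |z x / √t - √ℓ * (S m x / √m)|} ⊆
      {x | η * √ℓ * √m ≤ R x} ∪
        ({x | t < collisionTime ω S m₁ x} ∪ {x | collisionTime ω S m₂ x ≤ t}) := by
    intro x hx
    by_contra hc
    simp only [mem_union, mem_ofPred_eq, not_or, not_le, not_lt] at hc hx
    obtain ⟨hcR, hc₁, hc₂⟩ := hc
    have h1 := hS.abs_sub_mul_le hℓ hε hε1 hh (hz x) (show m₁ ≤ m by omega)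
      (show m ≤ m₂ by omega) hc₁ hc₂
    have h2 := abs_mul_sub_sqrt_mul_le hℓ hm0 ht₁ ht₂ (hS.abs_cast_le m x)
    have h3 := abs_sub_le (z x) (ℓ * S m x) (√t * (√ℓ * (S m x / √m)))
    have h4 : |z x / √t - √ℓ * (S m x / √m)| * √t = |z x - √t * (√ℓ * (S m x / √m))| := by
      have hst0 : 0 < √t := Real.sqrt_pos.2 ht0
      nth_rw 2 [← abs_of_pos hst0]
      rw [← abs_mul, sub_mul, div_mul_cancel₀ _ hst0.ne', mul_comm (√t)]
    have h5 : η * √ℓ * √m < R x := by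
      calc η * √ℓ * √m = η * (√ℓ * √m) := by ring
        _ ≤ η * √t := by gcongr
        _ < |z x / √t - √ℓ * (S m x / √m)| * √t := by gcongr
        _ ≤ R x := by rw [h4]; simp only [hR, hD]; linarith
    linarith
  refine (measureReal_mono hsub).trans ((measureReal_union_le _ _).trans (add_le_add ?_ ?_))
  · have hDint : ∫ x, |D x| ∂μ ≤ (2 + 6 * √K) / r * √m := by
      have h1 := hS.integral_abs_transform_le ha1 hK0 hK
        (hS.crossingWeight_bounded ω t m₁ m) (fun k => abs_crossingWeight_le ω S t m₁ m k)
        (m₁ := m₁) (m₂ := m₂) (by omega)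
        (fun k hk x => by rw [crossingWeight, if_neg (by omega)])
      refine h1.trans ?_
      have hw : ((m₂ - m₁ : ℕ) : ℝ) ≤ 3 * m / r ^ 2 := by
        rw [le_div_iff₀ (by positivity), Nat.cast_sub (by omega), hm₁R, hm₂R]
        nlinarith
      have hw1 : √((m₂ - m₁ : ℕ) : ℝ) ≤ 2 / r * √m := by
        rw [Real.sqrt_le_left (by positivity), mul_pow, Real.sq_sqrt hmR.le, div_pow]
        refine hw.trans ?_
        rw [div_mul_eq_mul_div]
        gcongr; linarith
      have hw2 : √(m : ℝ) / 2 ≤ √m₁ := by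
        refine Real.le_sqrt_of_sq_le ?_
        rw [div_pow, Real.sq_sqrt hmR.le, hm₁R]
        have : (4 : ℝ) * d ≤ m := by exact_mod_cast hd4
        linarith
      have hw3 : √K / √m₁ ≤ √K / (√m / 2) := by gcongr
      calc _ ≤ 2 / r * √m + 3 * m / r ^ 2 * (√K / (√m / 2)) := by gcongr
        _ = 2 / r * √m + 6 * √K / r ^ 2 * √m := by
            congr 1
            have := Real.sq_sqrt hmR.le
            field_simp
            rw [this]; ring
        _ ≤ 2 / r * √m + 6 * √K / r * √m := by
            gcongr
            exact le_self_pow₀ hr1 two_ne_zero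
        _ = (2 + 6 * √K) / r * √m := by ring
    have hRint : ∫ x, R x ∂μ ≤ ((3 * ℓ + 3 + 3 * C) / √m + (ℓ + 3) * ((2 + 6 * √K) / r) +
        3 * ε * √K) * √m := by
      have h1 : ∫ x, R x ∂μ = 3 * ℓ + 3 + 3 * C + (ℓ + 3) * ∫ x, |D x| ∂μ +
          3 * ε * ∫ x, |(S m x : ℝ)| ∂μ := by
        rw [hR, integral_add (bR1.integrable (ℱ.le m₂)) ((bSm.const_mul _).integrable (ℱ.le m₂)),
          integral_add (integrable_const _) ((bD.abs.const_mul _).integrable (ℱ.le m₂)),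
          integral_const_mul, integral_const_mul]
        simp
      have h2 := hS.integral_abs_le hK m
      rw [Real.sqrt_mul hK0] at h2
      have h5 : (3 * ℓ + 3 + 3 * C) / √m * √m = 3 * ℓ + 3 + 3 * C := div_mul_cancel₀ _ hsm.ne'
      rw [h1]
      have h3 := mul_le_mul_of_nonneg_left hDint (show 0 ≤ ℓ + 3 by linarith)
      have h4 := mul_le_mul_of_nonneg_left h2 (show 0 ≤ 3 * ε by linarith)
      linarith
    have hR0 : ∀ x, 0 ≤ R x := fun x => by simp only [hR]; positivity
    have h1 := mul_meas_ge_le_integral_of_nonneg (μ := μ) (Eventually.of_forall hR0)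
      (bR.integrable (ℱ.le m₂)) (η * √ℓ * √m)
    rw [le_div_iff₀ (by positivity)]
    refine le_of_mul_le_mul_right ?_ hsm
    linarith
  · refine (measureReal_union_le _ _).trans (add_le_add ?_ ?_)
    · refine hS.measureReal_collisionTime_le ω (c := ℓ * d) (by omega) (by positivity) ?_ ?_
      · rw [hm₁R, div_mul_eq_mul_div, le_div_iff₀ hℓ]
        nlinarith
      · intro x (hx : t < collisionTime ω S m₁ x)
        refine le_trans ?_ (le_abs_self _)
        rw [hm₁R]; linarith
    · refine hS.measureReal_collisionTime_le ω (c := ℓ * d) (by omega) (by positivity) ?_ ?_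
      · rw [hm₂R, div_mul_eq_mul_div, le_div_iff₀ hℓ]
        have : (4 : ℝ) * d ≤ m := by exact_mod_cast hd4
        nlinarith
      · intro x (hx : collisionTime ω S m₂ x ≤ t)
        refine le_trans ?_ (neg_le_abs _)
        rw [hm₂R]; linarith

/-- At time `t`, the rescaled trajectory is close in probability to the rescaled walk at time
`t / ℓ`. -/
lemma tendsto_measureReal_lt_abs_sub (hS : IsReinforcedWalk μ ℱ a S) (ha1 : |a| ≤ 1)
    (ha : a < 1 / 2) {ω : ℤ → ℝ} (hω : Monotone ω) (hω0 : ω 0 = 0) {ℓ : ℝ} (hℓ : 0 < ℓ)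
    (hsub : IsSublinear fun y => ω y - ℓ * y) {Z : ℝ → Ω → ℝ}
    (hZ : ∀ t x n, collisionTime ω S n x ≤ t → t < collisionTime ω S (n + 1) x →
      |Z t x - ω (S n x)| ≤ t - collisionTime ω S n x) {η : ℝ} (hη : 0 < η) :
    Tendsto (fun t => μ.real {x | η < |Z t x / √t - √ℓ * (S ⌊t / ℓ⌋₊ x / √(⌊t / ℓ⌋₊ : ℝ))|})
      atTop (𝓝 0) := by
  obtain ⟨K, hK0, hK⟩ := hS.exists_integral_sq_le ha
  have hlln := hS.tendsto_integral_abs_collisionTime_sub ha1 ha hω hω0 hsub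
  have hfloor : Tendsto (fun t : ℝ => ⌊t / ℓ⌋₊) atTop atTop :=
    tendsto_nat_floor_atTop.comp (tendsto_id.atTop_div_const hℓ)
  rw [Metric.tendsto_nhds]
  intro ρ hρ
  have hsl : 0 < √ℓ := Real.sqrt_pos.2 hℓ
  set θ := ρ * (η * √ℓ) / 4 with hθ
  have hθ0 : 0 < θ := by positivity
  obtain ⟨ε, hε, hε1, hεθ⟩ : ∃ ε, 0 < ε ∧ ε ≤ 1 ∧ 3 * ε * √K ≤ θ := by
    refine ⟨min 1 (θ / (3 * √K + 1)), by positivity, min_le_left _ _, ?_⟩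
    have h1 := min_le_right 1 (θ / (3 * √K + 1))
    rw [le_div_iff₀ (by positivity)] at h1
    have h2 : 0 < min 1 (θ / (3 * √K + 1)) := by positivity
    nlinarith
  obtain ⟨C, hC, hh⟩ := hsub ε hε
  obtain ⟨r, hr, hrθ⟩ : ∃ r : ℕ, 2 ≤ r ∧ (ℓ + 3) * ((2 + 6 * √K) / r) ≤ θ := by
    have h1 := (tendsto_const_div_atTop_nhds_zero_nat (2 + 6 * √K)).const_mul (ℓ + 3)
    rw [mul_zero] at h1
    obtain ⟨r, h2, h3⟩ := ((h1.eventually_le_const hθ0).and (eventually_ge_atTop 2)).exists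
    exact ⟨r, h3, h2⟩
  have hm₁ : Tendsto (fun m : ℕ => m - m / r ^ 2) atTop atTop := by
    refine tendsto_atTop_mono (f := fun m : ℕ => m / 2) (fun m => ?_)
      (Nat.tendsto_div_const_atTop two_ne_zero)
    have : m / r ^ 2 ≤ m / 2 := Nat.div_le_div_left (by nlinarith) two_pos
    omega
  have hm₂ : Tendsto (fun m : ℕ => m + 1 + m / r ^ 2) atTop atTop :=
    tendsto_atTop_mono (fun m => (Nat.le_succ m).trans (Nat.le_add_right _ _)) tendsto_id
  have hC' : Tendsto (fun m : ℕ => (3 * ℓ + 3 + 3 * C) / √(m : ℝ)) atTop (𝓝 0) :=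
    (Real.tendsto_sqrt_atTop.comp tendsto_natCast_atTop_atTop).const_div_atTop _
  have hbad := ((hlln.comp hm₁).const_mul (2 * (r : ℝ) ^ 2 / ℓ)).add
    ((hlln.comp hm₂).const_mul (6 * (r : ℝ) ^ 2 / ℓ))
  simp only [mul_zero, add_zero] at hbad
  have ev := ((eventually_ge_atTop (r ^ 2)).and ((hC'.eventually_lt_const hθ0).and
    (hbad.eventually_lt_const (show 0 < ρ / 4 by positivity))))
  filter_upwards [hfloor.eventually ev, eventually_ge_atTop 0] with t ⟨h1, h2, h3⟩ ht0
  rw [Real.dist_eq, sub_zero, abs_of_nonneg measureReal_nonneg]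
  have f1 : ℓ * ⌊t / ℓ⌋₊ ≤ t := by
    have := Nat.floor_le (div_nonneg ht0 hℓ.le)
    rwa [le_div_iff₀ hℓ, mul_comm] at this
  have f2 : t < ℓ * (⌊t / ℓ⌋₊ + 1) := by
    have := Nat.lt_floor_add_one (t / ℓ)
    rwa [div_lt_iff₀ hℓ, mul_comm] at this
  refine (hS.measureReal_lt_abs_sub_le ha1 hK0.le hK hℓ hε.le hε1 hC hh (hZ t) hr h1 f1 f2
    hη).trans_lt ?_
  simp only [Function.comp] at h3
  have h4 : ((3 * ℓ + 3 + 3 * C) / √(⌊t / ℓ⌋₊ : ℝ) + (ℓ + 3) * ((2 + 6 * √K) / r) +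
      3 * ε * √K) / (η * √ℓ) ≤ 3 * ρ / 4 := by
    rw [div_le_iff₀ (by positivity)]
    have : 3 * ρ / 4 * (η * √ℓ) = 3 * θ := by rw [hθ]; ring
    linarith
  linarith

end IsReinforcedWalk

/-- Theorem 2.3, continuous-time part: quenched CLT for the continuous-time step-reinforced
Lévy–Lorentz gas.  For `0 ≤ p < 3/4`, `X̃^{(p)}_t/√t` converges in distribution, as `t → ∞`,
to `N(0, ℓ(3 − 4p)⁻¹)`, stated via convergence of CDFs. -/
theorem reinforced_levy_lorentz_continuous_CLT
    {Ω : Type*} [MeasurableSpace Ω] (μ : Measure Ω) [IsProbabilityMeasure μ]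
    -- scatterers
    (ω : ℤ → ℝ) (hmono : StrictMono ω) (hω0 : ω 0 = 0)
    (ℓ : ℝ) (hℓ : 0 < ℓ)
    (hLLN : ∀ (α : ℝ) (β : ℤ),
      Tendsto (fun n : ℕ => ω ⌊α * n + β⌋ / n) atTop (𝓝 (α * ℓ)))
    -- step-reinforced walk with memory parameter p
    (p : ℝ) (hp0 : 0 ≤ p) (hp34 : p < 3 / 4)
    (V : ℕ → Ω → ℤ) (hVmeas : ∀ n, Measurable (V n))
    (hVval : ∀ n a, 1 ≤ n → V n a = 1 ∨ V n a = -1)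
    (hV1 : μ {a | V 1 a = 1} = 1 / 2)
    (S : ℕ → Ω → ℤ) (hS : ∀ n a, S n a = ∑ k ∈ Finset.range n, V (k + 1) a)
    (hcond : ∀ n : ℕ, 1 ≤ n →
      μ[({a | V (n + 1) a = 1}).indicator (fun _ => (1 : ℝ)) |
          ⨆ k ∈ Set.Icc 1 n, MeasurableSpace.comap (V k) inferInstance]
        =ᵐ[μ] fun a => 1 / 2 + (2 * p - 1) * (S n a : ℝ) / (2 * n))
    -- the step-reinforced Lévy–Lorentz gas and its collision times
    (X : ℕ → Ω → ℝ) (hX : ∀ n a, X n a = ω (S n a))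
    (T : ℕ → Ω → ℝ)
    (hT : ∀ n a, T n a = ∑ k ∈ Finset.range n, |X (k + 1) a - X k a|)
    -- the continuous-time step-reinforced Lévy–Lorentz gas
    (Xt : ℝ → Ω → ℝ)
    (hXt : ∀ (a : Ω) (n : ℕ), 1 ≤ n → ∀ t : ℝ, T (n - 1) a ≤ t → t < T n a →
      Xt t a = ω (S (n - 1) a) + (V n a : ℝ) * (t - T (n - 1) a)) :
    ∀ x : ℝ,
      Tendsto (fun t : ℝ => (μ {a | Xt t a / Real.sqrt t ≤ x}).toReal) atTop
        (𝓝 ((gaussianReal 0 (Real.toNNReal (ℓ * (3 - 4 * p)⁻¹))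
            (Set.Iic x)).toReal)) := by
  have hW := isReinforcedWalk_of_condExp hVmeas hVval hV1 hS hcond
  have ha1 : |2 * p - 1| ≤ 1 := abs_le.2 ⟨by linarith, by linarith⟩
  have ha : 2 * p - 1 < 1 / 2 := by linarith
  have hTc : ∀ n b, T n b = collisionTime ω S n b := fun n b => by
    simp only [hT, hX, collisionTime]
  have hsub : IsSublinear fun y => ω y - ℓ * y := by
    have h1 := hLLN 1 0
    have h2 := hLLN (-1) 0
    simp only [one_mul, neg_mul, Int.cast_zero, add_zero, Int.floor_natCast] at h1 h2
    refine isSublinear_sub_mul h1 (h2.congr fun n => ?_)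
    rw [← Int.cast_natCast (R := ℝ) n, ← Int.cast_neg, Int.floor_intCast]
  have hZ : ∀ t b n, collisionTime ω S n b ≤ t → t < collisionTime ω S (n + 1) b →
      |Xt t b - ω (S n b)| ≤ t - collisionTime ω S n b := by
    intro t b n h1 h2
    rw [← hTc] at h1 h2 ⊢
    have h3 := hXt b (n + 1) (by omega) t h1 h2
    rw [Nat.add_sub_cancel] at h3
    rw [h3, add_sub_cancel_left, abs_mul, abs_of_nonneg (sub_nonneg.2 h1)]
    rcases hVval (n + 1) b (by omega) with h | h <;> simp [h]
  have hvar : Real.toNNReal (ℓ * (3 - 4 * p)⁻¹) ≠ 0 := by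
    have : 0 < 3 - 4 * p := by linarith
    rw [Ne, Real.toNNReal_eq_zero, not_le]
    positivity
  have : NullSingletonClass (gaussianReal 0 (Real.toNNReal (ℓ * (3 - 4 * p)⁻¹))) :=
    nullSingletonClass_gaussianReal hvar
  have hclt : ∀ x, Tendsto (fun n : ℕ => μ.real {b | √ℓ * (S n b / √n) ≤ x}) atTop
      (𝓝 ((gaussianReal 0 (Real.toNNReal (ℓ * (3 - 4 * p)⁻¹))).real (Iic x))) := by
    intro x
    have h := hW.tendsto_measure_div_sqrt_le ha1 ha hℓ x
    rwa [show 1 - 2 * (2 * p - 1) = 3 - 4 * p by ring] at h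
  exact tendsto_measureReal_le_of_approx
    (tendsto_nat_floor_atTop.comp (tendsto_id.atTop_div_const hℓ))
    (continuous_measureReal_Iic _) hclt
    (fun η hη => hW.tendsto_measureReal_lt_abs_sub ha1 ha hmono.monotone hω0 hℓ hsub hZ hη)
end

section
/- Lemma 3.7 (asymptotic normality of the step-reinforced random walk in the diffusive regime): for every 0 ≤ p < 3/4 and every x ∈ ℝ, lim_{n→∞} P(S^{(p)}_n/√n ≤ (3 − 4p)^{−1/2} x) = (2π)^{−1/2} ∫_{−∞}^x e^{−t²/2} dt; that is, S^{(p)}_n/√n converges in distribution to a centered Gaussian random variable with variance (3 − 4p)^{−1}. -/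
open MeasureTheory ProbabilityTheory Filter Set Topology

/-- Second-order comparison of `cos θ + i y sin θ` with `exp (-θ² / 2 + i θ y)`. -/
lemma norm_cos_add_sin_mul_I_sub_exp_le {θ y : ℝ} (hθ : |θ| ≤ 1 / 2) (hy : |y| ≤ 1) :
    ‖((Real.cos θ : ℂ) + y * Real.sin θ * Complex.I)
      - Complex.exp (-θ ^ 2 / 2 + θ * y * Complex.I)‖ ≤ θ ^ 2 * y ^ 2 + 2 * |θ| ^ 3 := by
  set z : ℂ := -θ ^ 2 / 2 + θ * y * Complex.I with hz
  have hz_eq : z = ((-θ ^ 2 / 2 : ℝ) : ℂ) + ((θ * y : ℝ) : ℂ) * Complex.I := by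
    rw [hz]; push_cast; ring
  have hθ0 := abs_nonneg θ
  have hz_sq : ‖z‖ ^ 2 = θ ^ 4 / 4 + θ ^ 2 * y ^ 2 := by
    rw [← Complex.normSq_eq_norm_sq, hz_eq, Complex.normSq_add_mul_I]; ring
  have hθ2 : θ ^ 2 ≤ 1 / 4 := by rw [← sq_abs]; nlinarith
  have hy2 : y ^ 2 ≤ 1 := by rw [← sq_abs]; nlinarith [abs_nonneg y]
  have hz_le : ‖z‖ ≤ 1 := by
    have : ‖z‖ ^ 2 ≤ 1 := by rw [hz_sq]; nlinarith [sq_nonneg θ, sq_nonneg y]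
    nlinarith [norm_nonneg z]
  have h_exp := Complex.norm_exp_sub_one_sub_id_le hz_le
  have h_cos := Real.cos_bound (x := θ) (by linarith)
  have h_sin := Real.sin_bound (x := θ) (by linarith)
  have h_sin' : |Real.sin θ - θ| ≤ |θ| ^ 3 / 4 := by
    have h_cube : |θ ^ 3 / 6| = |θ| ^ 3 / 6 := by rw [abs_div, abs_pow]; norm_num
    calc |Real.sin θ - θ| = |(Real.sin θ - (θ - θ ^ 3 / 6)) + -(θ ^ 3 / 6)| := by ring_nf
      _ ≤ |Real.sin θ - (θ - θ ^ 3 / 6)| + |θ ^ 3 / 6| := by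
        rw [← abs_neg (θ ^ 3 / 6)]; exact abs_add_le _ _
      _ ≤ |θ| ^ 5 / 100 + |θ| ^ 3 / 6 := by rw [h_cube]; gcongr
      _ = |θ| ^ 3 * (|θ| ^ 2 / 100 + 1 / 6) := by ring
      _ ≤ |θ| ^ 3 * (1 / 4) := by gcongr; rw [sq_abs]; linarith
      _ = |θ| ^ 3 / 4 := by ring
  have h_split : ((Real.cos θ : ℂ) + y * Real.sin θ * Complex.I) - Complex.exp z
      = ((Real.cos θ - (1 - θ ^ 2 / 2) : ℝ) : ℂ)
        + ((y * (Real.sin θ - θ) : ℝ) : ℂ) * Complex.I - (Complex.exp z - 1 - z) := by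
    rw [hz]; push_cast; ring
  have h_mul : |y * (Real.sin θ - θ)| ≤ |θ| ^ 3 / 4 := by
    rw [abs_mul]; nlinarith [abs_nonneg (Real.sin θ - θ)]
  have h_four : θ ^ 4 ≤ |θ| ^ 3 := by
    rw [← Even.pow_abs (by decide : Even 4)]; nlinarith [pow_nonneg hθ0 3]
  have h_four' : |θ| ^ 4 ≤ |θ| ^ 3 := by nlinarith [pow_nonneg hθ0 3]
  rw [h_split]
  refine (norm_sub_le _ _).trans ?_
  have h_add := norm_add_le ((Real.cos θ - (1 - θ ^ 2 / 2) : ℝ) : ℂ)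
    (((y * (Real.sin θ - θ) : ℝ) : ℂ) * Complex.I)
  rw [norm_mul, Complex.norm_I, mul_one, Complex.norm_real, Complex.norm_real, Real.norm_eq_abs,
    Real.norm_eq_abs] at h_add
  nlinarith [pow_nonneg hθ0 3]

/-- For `c < q ≤ 1` the increment of `n ↦ n ^ q` eventually dominates multiplication by
`1 + (c + (q - c) / 2) / n`. -/
lemma eventually_rpow_mul_one_add_div_le {c q : ℝ} (hc : c < q) (hq0 : 0 < q) (hq1 : q ≤ 1) :
    ∀ᶠ n : ℕ in atTop, (n : ℝ) ^ q * (1 + (c + (q - c) / 2) / n) ≤ ((n + 1 : ℕ) : ℝ) ^ q := by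
  filter_upwards [eventually_ge_atTop 1,
    (tendsto_natCast_atTop_atTop (R := ℝ)).eventually_ge_atTop (2 * q / (q - c))] with n hn hn'
  have hn0 : (0 : ℝ) < n := by exact_mod_cast hn
  have hbern := rpow_one_add_le_one_add_mul_self (s := -(1 / ((n : ℝ) + 1)))
    (by rw [neg_le_neg_iff, div_le_one (by positivity)]; linarith) hq0.le hq1
  have hquot : 1 + -(1 / ((n : ℝ) + 1)) = n / (n + 1) := by field_simp; ring
  rw [hquot, Real.div_rpow hn0.le (by positivity), div_le_iff₀ (by positivity)] at hbern
  set Y := ((n : ℝ) + 1) ^ q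
  have hY : 0 < Y := by positivity
  push_cast
  rw [div_le_iff₀ (by linarith)] at hn'
  have hfac : (1 + q * -(1 / ((n : ℝ) + 1))) * (1 + (c + (q - c) / 2) / n) ≤ 1 := by
    have hid : (1 + q * -(1 / ((n : ℝ) + 1))) * (1 + (c + (q - c) / 2) / n)
        = ((n + 1 - q) * (n + (c + q) / 2)) / (n * (n + 1)) := by field_simp; ring
    rw [hid, div_le_one (by positivity)]
    nlinarith [mul_nonneg (sub_nonneg.2 hq1) (sub_nonneg.2 hc.le), mul_pos hq0 hq0]
  rcases le_or_gt 0 (1 + (c + (q - c) / 2) / n) with h | h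
  · nlinarith [mul_le_mul_of_nonneg_right hbern h]
  · have : 0 ≤ (n : ℝ) ^ q := by positivity
    nlinarith

/-- A family of errors obeying `D (n + 1) θ ≤ D n (θ (1 + c / n)) + C (θ² / n + |θ|³)` with
`c < 1 / 2` vanishes on the diffusive scale. -/
lemma tendsto_div_sqrt_of_recursive_bound {D : ℕ → ℝ → ℝ} {c C : ℝ} (hc1 : -1 ≤ c)
    (hc2 : c < 1 / 2) (hC : 0 ≤ C) (hD0 : ∀ n θ, 0 ≤ D n θ) (hD2 : ∀ n θ, D n θ ≤ 2)
    (hDlin : ∀ n, ∃ L, ∀ θ, |θ| ≤ 1 / 2 → D n θ ≤ L * |θ|)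
    (hDstep : ∀ n : ℕ, 1 ≤ n → ∀ θ, |θ| ≤ 1 / 2 →
      D (n + 1) θ ≤ D n (θ * (1 + c / n)) + C * (θ ^ 2 / n + |θ| ^ 3)) (t : ℝ) :
    Tendsto (fun n : ℕ => D n (t / Real.sqrt n)) atTop (𝓝 0) := by
  obtain ⟨q, hq_lo, hq_hi⟩ := exists_between (max_lt hc2 (by norm_num : (1 / 3 : ℝ) < 1 / 2))
  obtain ⟨hcq, hq3⟩ := max_lt_iff.1 hq_lo
  obtain ⟨N, hN⟩ := eventually_atTop.1
    (eventually_rpow_mul_one_add_div_le hcq (by linarith) (by linarith))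
  set k := (q - c) / 2 with hk
  have hk0 : 0 < k := by rw [hk]; linarith
  obtain ⟨L, hL⟩ := hDlin (N + 1)
  set A := max (max 4 L) (2 * C / k) with hA
  have hA4 : 4 ≤ A := (le_max_left _ _).trans (le_max_left _ _)
  have hAL : L ≤ A := (le_max_right _ _).trans (le_max_left _ _)
  have hAC : 2 * C ≤ A * k := (div_le_iff₀ hk0).1 (le_max_right _ _)
  have hbound : ∀ n, N + 1 ≤ n → ∀ θ, D n θ ≤ A * ((n : ℝ) ^ q * |θ|) := by
    intro n hn
    induction n, hn using Nat.le_induction with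
    | base =>
      intro θ
      have h1 : 1 ≤ ((N + 1 : ℕ) : ℝ) ^ q :=
        Real.one_le_rpow (by exact_mod_cast Nat.le_add_left 1 N) (by linarith)
      have h2 : |θ| ≤ ((N + 1 : ℕ) : ℝ) ^ q * |θ| := le_mul_of_one_le_left (abs_nonneg _) h1
      rcases le_or_gt |θ| (1 / 2) with h | h
      · exact (hL θ h).trans (mul_le_mul hAL h2 (abs_nonneg _) (by linarith))
      · nlinarith [hD2 (N + 1) θ]
    | succ n hn ih =>
      intro θ
      have hn1 : (1 : ℝ) ≤ n := by exact_mod_cast (Nat.le_add_left 1 N).trans hn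
      have hn0 : (0 : ℝ) < n := by linarith
      have hrpow := hN n (by omega)
      set X := (n : ℝ) ^ q with hX
      set Y := ((n + 1 : ℕ) : ℝ) ^ q with hY
      have hX1 : 1 ≤ X := Real.one_le_rpow hn1 (by linarith)
      have hXY : X ≤ Y := Real.rpow_le_rpow hn0.le (by push_cast; linarith) (by linarith)
      have hXn : (n : ℝ) ≤ X ^ 3 := by
        rw [hX, ← Real.rpow_natCast, ← Real.rpow_mul hn0.le]
        exact Real.self_le_rpow_of_one_le hn1 (by push_cast; linarith)
      have hθ0 := abs_nonneg θ
      rcases le_or_gt (1 / 2) (Y * |θ|) with h | h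
      · nlinarith [hD2 (n + 1) θ]
      have hXθ : X * |θ| ≤ 1 / 2 := by nlinarith
      have hθ : |θ| ≤ 1 / 2 := by nlinarith
      have hc_nonneg : 0 ≤ 1 + c / n := by
        rw [← neg_le_iff_add_nonneg', le_div_iff₀ hn0]; nlinarith
      have herr : θ ^ 2 / n + |θ| ^ 3 ≤ 2 * (X * |θ| / n) := by
        have h1 : θ ^ 2 / n ≤ X * |θ| / n := by
          rw [← sq_abs]; gcongr; nlinarith
        have h2 : |θ| ^ 3 ≤ X * |θ| / n := by
          rw [le_div_iff₀ hn0]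
          have h3 : (X * |θ|) ^ 2 ≤ 1 := by nlinarith [mul_nonneg (zero_le_one.trans hX1) hθ0]
          calc |θ| ^ 3 * n ≤ |θ| ^ 3 * X ^ 3 := by gcongr
            _ = (X * |θ|) ^ 2 * (X * |θ|) := by ring
            _ ≤ 1 * (X * |θ|) := by gcongr
            _ = X * |θ| := one_mul _
        linarith
      calc D (n + 1) θ ≤ D n (θ * (1 + c / n)) + C * (θ ^ 2 / n + |θ| ^ 3) :=
            hDstep n (by omega) θ hθ
        _ ≤ A * (X * |θ * (1 + c / n)|) + C * (2 * (X * |θ| / n)) := by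
            gcongr; exact ih _
        _ = A * X * |θ| * (1 + c / n) + 2 * C * (X * |θ| / n) := by
            rw [abs_mul, abs_of_nonneg hc_nonneg]; ring
        _ ≤ A * X * |θ| * (1 + c / n) + A * k * (X * |θ| / n) := by gcongr
        _ = A * |θ| * (X * (1 + (c + k) / n)) := by ring
        _ ≤ A * |θ| * Y := by gcongr
        _ = A * (Y * |θ|) := by ring
  have hlim : Tendsto (fun n : ℕ => A * |t| * (n : ℝ) ^ (-(1 / 2 - q))) atTop (𝓝 0) := by
    simpa using ((tendsto_rpow_neg_atTop (by linarith : 0 < 1 / 2 - q)).comp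
      tendsto_natCast_atTop_atTop).const_mul (A * |t|)
  refine squeeze_zero' (.of_forall fun n => hD0 _ _) ?_ hlim
  filter_upwards [eventually_ge_atTop (N + 1)] with n hn
  have hn0 : (0 : ℝ) < n := by exact_mod_cast (Nat.succ_pos N).trans_le hn
  refine (hbound n hn _).trans_eq ?_
  rw [abs_div, abs_of_nonneg (Real.sqrt_nonneg _), Real.sqrt_eq_rpow, neg_sub,
    Real.rpow_sub hn0]
  ring

/-- Every function of a bounded integer-valued random variable is integrable. -/
lemma integrable_comp_of_abs_le {Ω E : Type*} [MeasurableSpace Ω] {μ : Measure Ω}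
    [IsFiniteMeasure μ] [NormedAddCommGroup E] {W : Ω → ℤ} (hW : Measurable W)
    {N : ℕ} (hN : ∀ a, |W a| ≤ N) (f : ℤ → E) :
    Integrable (fun a => f (W a)) μ := by
  refine .of_bound ((StronglyMeasurable.of_discrete (f := f)).comp_measurable
    hW).aestronglyMeasurable (∑ j ∈ Finset.Icc (-(N : ℤ)) N, ‖f j‖) (.of_forall fun a => ?_)
  exact Finset.single_le_sum (f := fun j => ‖f j‖) (fun _ _ => norm_nonneg _)
    (Finset.mem_Icc.2 (abs_le.1 (hN a)))

/-- If a `±1`-valued step `U` has conditional mean `r W` given a σ-algebra for which the bounded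
integer variable `W` is measurable, then `U` may be replaced by `r W` against functions of `W`. -/
lemma integral_step_mul_comp {Ω : Type*} {m mΩ : MeasurableSpace Ω} {μ : Measure Ω}
    [IsFiniteMeasure μ] (hm : m ≤ mΩ) {W U : Ω → ℤ} (hW : Measurable[m] W)
    {N : ℕ} (hN : ∀ a, |W a| ≤ N) (hU : Measurable U) (hUval : ∀ a, U a = 1 ∨ U a = -1) {r : ℝ}
    (hcond : μ[({a | U a = 1}).indicator (fun _ => (1 : ℝ)) | m]
      =ᵐ[μ] fun a => 1 / 2 + r * W a / 2) (f : ℤ → ℂ) :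
    ∫ a, (U a : ℂ) * f (W a) ∂μ = ∫ a, ((r * W a : ℝ) : ℂ) * f (W a) ∂μ := by
  set g : Ω → ℝ := ({a | U a = 1}).indicator (fun _ => (1 : ℝ)) with hg
  have hset : MeasurableSet {a | U a = 1} := hU (measurableSet_singleton 1)
  have hg_int : Integrable g μ := (integrable_const 1).indicator hset
  have hf_int : Integrable (fun a => f (W a)) μ :=
    integrable_comp_of_abs_le (hW.mono hm le_rfl) hN f
  have hUg : ∀ a, (U a : ℂ) * f (W a) = (2 : ℂ) * (g • fun a => f (W a)) a - f (W a) := by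
    intro a
    rcases hUval a with h | h <;>
      simp [hg, Set.indicator, h]
    ring
  have hgf_int : Integrable (g • fun a => f (W a)) μ := by
    refine hf_int.mono (hg_int.aestronglyMeasurable.smul hf_int.aestronglyMeasurable)
      (.of_forall fun a => ?_)
    by_cases h : U a = 1 <;> simp [hg, Set.indicator, h]
  have hpull := condExp_smul_of_aestronglyMeasurable_right hg_int hgf_int
    ((StronglyMeasurable.of_discrete (f := f)).comp_measurable hW).aestronglyMeasurable
  have hint : ∫ a, (g • fun a => f (W a)) a ∂μ
      = ∫ a, ((1 / 2 + r * W a / 2 : ℝ) : ℂ) * f (W a) ∂μ := by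
    rw [← integral_condExp hm]
    refine integral_congr_ae ?_
    filter_upwards [hpull, hcond] with a h1 h2
    rw [h1, Pi.smul_apply', h2, Complex.real_smul]
  have hrhs_int : Integrable (fun a => ((1 / 2 + r * W a / 2 : ℝ) : ℂ) * f (W a)) μ :=
    integrable_comp_of_abs_le (hW.mono hm le_rfl) hN
      fun j => ((1 / 2 + r * j / 2 : ℝ) : ℂ) * f j
  simp_rw [hUg]
  rw [integral_sub (hgf_int.const_mul 2) hf_int, integral_const_mul, hint, ← integral_const_mul,
    ← integral_sub (hrhs_int.const_mul 2) hf_int]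
  congr with a
  push_cast
  ring

section LinearlyReinforced

variable {Ω : Type*} {mΩ : MeasurableSpace Ω} {μ : Measure Ω} [IsProbabilityMeasure μ]
  {V S : ℕ → Ω → ℤ} {c : ℝ}

/-- The second moment of the walk grows at most linearly. -/
lemma reinforced_walk_integral_sq_le (hSmeas : ∀ n, Measurable (S n))
    (hVmeas : ∀ n, Measurable (V n))
    (hVval : ∀ n a, 1 ≤ n → V n a = 1 ∨ V n a = -1)
    (hSsucc : ∀ n a, S (n + 1) a = S n a + V (n + 1) a) (hSabs : ∀ n a, |S n a| ≤ n)
    (hstep : ∀ n : ℕ, 1 ≤ n → ∀ f : ℤ → ℂ,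
      ∫ a, (V (n + 1) a : ℂ) * f (S n a) ∂μ = ∫ a, ((c / n * S n a : ℝ) : ℂ) * f (S n a) ∂μ)
    (hc : c < 1 / 2) {n : ℕ} (hn : 1 ≤ n) :
    ∫ a, (S n a : ℝ) ^ 2 ∂μ ≤ (1 - 2 * max c 0)⁻¹ * n := by
  have hc' : 0 < 1 - 2 * max c 0 := by
    have : max c 0 < 1 / 2 := max_lt hc (by norm_num)
    linarith
  set K := (1 - 2 * max c 0)⁻¹ with hK
  have hK1 : K - 2 * max c 0 * K = 1 := by rw [hK]; field_simp
  have hsq_int : ∀ n, Integrable (fun a => (S n a : ℝ) ^ 2) μ := fun n =>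
    integrable_comp_of_abs_le (hSmeas n) (hSabs n) fun j => (j : ℝ) ^ 2
  induction n, hn using Nat.le_induction with
  | base =>
    have hone : ∀ a, (S 1 a : ℝ) ^ 2 ≤ 1 := fun a => by
      have := hSabs 1 a
      rw [sq_le_one_iff_abs_le_one]
      exact_mod_cast this
    have h1 : ∫ a, (S 1 a : ℝ) ^ 2 ∂μ ≤ 1 := by
      simpa using integral_mono (hsq_int 1) (integrable_const (1 : ℝ)) hone
    have hK' : 1 ≤ K := one_le_inv_iff₀.2 ⟨hc', by linarith [le_max_right c 0]⟩
    simpa using h1.trans hK'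
  | succ n hn ih =>
    have hn0 : (0 : ℝ) < n := by exact_mod_cast hn
    have hcross : ∫ a, (V (n + 1) a : ℝ) * S n a ∂μ = c / n * ∫ a, (S n a : ℝ) ^ 2 ∂μ := by
      have h := hstep n hn fun j => (j : ℂ)
      rw [← integral_const_mul]
      apply Complex.ofReal_injective
      rw [← integral_complex_ofReal, ← integral_complex_ofReal]
      refine Eq.trans ?_ (h.trans ?_) <;> congr with a <;> push_cast <;> ring
    have hcross_int : Integrable (fun a => (V (n + 1) a : ℝ) * S n a) μ := by
      refine (integrable_comp_of_abs_le (hSmeas n) (hSabs n) fun j => (j : ℝ)).mono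
        (by have := hSmeas n; have := hVmeas (n + 1); fun_prop) (.of_forall fun a => ?_)
      rcases hVval (n + 1) a (by omega) with h | h <;> simp [h]
    have hexpand : ∀ a, (S (n + 1) a : ℝ) ^ 2
        = ((S n a : ℝ) ^ 2 + 2 * ((V (n + 1) a : ℝ) * S n a)) + 1 := by
      intro a
      rw [hSsucc]
      rcases hVval (n + 1) a (by omega) with h | h <;> rw [h] <;> push_cast <;> ring
    have hrec : ∫ a, (S (n + 1) a : ℝ) ^ 2 ∂μ
        = ∫ a, (S n a : ℝ) ^ 2 ∂μ + 2 * (c / n * ∫ a, (S n a : ℝ) ^ 2 ∂μ) + 1 := by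
      simp_rw [hexpand]
      have hsum_int : Integrable (fun a => (S n a : ℝ) ^ 2 + 2 * ((V (n + 1) a : ℝ) * S n a)) μ :=
        (hsq_int n).add (hcross_int.const_mul 2)
      rw [integral_add hsum_int (integrable_const 1),
        integral_add (hsq_int n) (hcross_int.const_mul 2), integral_const_mul, hcross]
      simp
    have hM0 : 0 ≤ ∫ a, (S n a : ℝ) ^ 2 ∂μ := integral_nonneg fun a => sq_nonneg _
    rw [hrec]
    set M := ∫ a, (S n a : ℝ) ^ 2 ∂μ
    have hcM : c / n * M ≤ max c 0 * K := by
      calc c / n * M ≤ max c 0 / n * (K * n) := by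
            gcongr
            exact le_max_left _ _
        _ = max c 0 * K := by field_simp
    push_cast
    linarith

/-- One step of the walk acts on the characteristic function, up to a small error, as a Gaussian
factor combined with a dilation of the argument. -/
lemma reinforced_walk_norm_charFun_step_le (hSmeas : ∀ n, Measurable (S n))
    (hVmeas : ∀ n, Measurable (V n))
    (hVval : ∀ n a, 1 ≤ n → V n a = 1 ∨ V n a = -1)
    (hSsucc : ∀ n a, S (n + 1) a = S n a + V (n + 1) a) (hSabs : ∀ n a, |S n a| ≤ n)
    (hstep : ∀ n : ℕ, 1 ≤ n → ∀ f : ℤ → ℂ,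
      ∫ a, (V (n + 1) a : ℂ) * f (S n a) ∂μ = ∫ a, ((c / n * S n a : ℝ) : ℂ) * f (S n a) ∂μ)
    (hc1 : -1 ≤ c) (hc : c < 1 / 2) {n : ℕ} (hn : 1 ≤ n) {θ : ℝ} (hθ : |θ| ≤ 1 / 2) :
    ‖∫ a, Complex.exp (θ * S (n + 1) a * Complex.I) ∂μ - Complex.exp (-θ ^ 2 / 2) *
        ∫ a, Complex.exp ((θ * (1 + c / n) : ℝ) * S n a * Complex.I) ∂μ‖
      ≤ θ ^ 2 / n * (1 - 2 * max c 0)⁻¹ + 2 * |θ| ^ 3 := by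
  have hn0 : (0 : ℝ) < n := by exact_mod_cast hn
  have hint : ∀ f : ℤ → ℂ, Integrable (fun a => f (S n a)) μ := fun f =>
    integrable_comp_of_abs_le (hSmeas n) (hSabs n) f
  have hpoint : ∀ a, Complex.exp (θ * S (n + 1) a * Complex.I)
      = Real.cos θ * Complex.exp (θ * S n a * Complex.I)
        + (V (n + 1) a : ℂ) * (Real.sin θ * Complex.I * Complex.exp (θ * S n a * Complex.I)) := by
    intro a
    have hexp : Complex.exp (θ * (V (n + 1) a : ℂ) * Complex.I)
        = Real.cos θ + V (n + 1) a * Real.sin θ * Complex.I := by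
      rcases hVval (n + 1) a (by omega) with h | h
      · simp [h, Complex.exp_mul_I]
      · simp only [h, Int.cast_neg, Int.cast_one, mul_neg, mul_one, Complex.exp_mul_I,
          Complex.cos_neg, Complex.sin_neg, Complex.ofReal_cos, Complex.ofReal_sin]
        ring
    rw [hSsucc]
    push_cast
    rw [mul_add, add_mul, Complex.exp_add, hexp]
    push_cast
    ring
  have hV_int : Integrable (fun a => (V (n + 1) a : ℂ)
      * (Real.sin θ * Complex.I * Complex.exp (θ * S n a * Complex.I))) μ := by
    refine (hint fun j => Real.sin θ * Complex.I * Complex.exp (θ * j * Complex.I)).mono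
      (by have := hSmeas n; have := hVmeas (n + 1); fun_prop) (.of_forall fun a => ?_)
    rcases hVval (n + 1) a (by omega) with h | h <;> simp [h]
  have hrec : ∫ a, Complex.exp (θ * S (n + 1) a * Complex.I) ∂μ
      = ∫ a, (Real.cos θ + ((c / n * S n a : ℝ) : ℂ) * Real.sin θ * Complex.I)
          * Complex.exp (θ * S n a * Complex.I) ∂μ := by
    simp_rw [hpoint]
    rw [integral_add (hint fun j => Real.cos θ * Complex.exp (θ * j * Complex.I)) hV_int,
      hstep n hn fun j => Real.sin θ * Complex.I * Complex.exp (θ * j * Complex.I),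
      ← integral_add (hint fun j => Real.cos θ * Complex.exp (θ * j * Complex.I))
        (hint fun j => ((c / n * j : ℝ) : ℂ)
          * (Real.sin θ * Complex.I * Complex.exp (θ * j * Complex.I)))]
    congr with a
    ring
  rw [hrec, ← integral_const_mul,
    ← integral_sub (hint fun j => (Real.cos θ + ((c / n * j : ℝ) : ℂ) * Real.sin θ * Complex.I)
      * Complex.exp (θ * j * Complex.I)) (hint fun j => Complex.exp (-θ ^ 2 / 2)
      * Complex.exp ((θ * (1 + c / n) : ℝ) * j * Complex.I))]
  have hbound : ∀ a, ‖(Real.cos θ + ((c / n * S n a : ℝ) : ℂ) * Real.sin θ * Complex.I)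
      * Complex.exp (θ * S n a * Complex.I) - Complex.exp (-θ ^ 2 / 2)
      * Complex.exp ((θ * (1 + c / n) : ℝ) * S n a * Complex.I)‖
      ≤ θ ^ 2 / n ^ 2 * (S n a : ℝ) ^ 2 + 2 * |θ| ^ 3 := by
    intro a
    have hfactor : Complex.exp (-θ ^ 2 / 2)
        * Complex.exp ((θ * (1 + c / n) : ℝ) * S n a * Complex.I)
        = Complex.exp (-θ ^ 2 / 2 + θ * ((c / n * S n a : ℝ) : ℂ) * Complex.I)
          * Complex.exp (θ * S n a * Complex.I) := by
      rw [← Complex.exp_add, ← Complex.exp_add]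
      push_cast
      ring_nf
    have hunit : ‖Complex.exp (θ * S n a * Complex.I)‖ = 1 := by
      exact_mod_cast Complex.norm_exp_ofReal_mul_I (θ * S n a)
    have hcabs : |c| ≤ 1 := abs_le.2 ⟨hc1, by linarith⟩
    have hSa : |(S n a : ℝ)| ≤ n := by exact_mod_cast hSabs n a
    have hy : |c / n * S n a| ≤ 1 := by
      rw [div_mul_eq_mul_div, abs_div, abs_mul, abs_of_pos hn0, div_le_one hn0]
      nlinarith [abs_nonneg (S n a : ℝ)]
    rw [hfactor, ← sub_mul, norm_mul, hunit, mul_one]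
    refine (norm_cos_add_sin_mul_I_sub_exp_le hθ hy).trans ?_
    have hc2 : c ^ 2 ≤ 1 := (sq_le_one_iff_abs_le_one c).2 hcabs
    calc θ ^ 2 * (c / n * S n a) ^ 2 + 2 * |θ| ^ 3
        = c ^ 2 * (θ ^ 2 / n ^ 2 * (S n a : ℝ) ^ 2) + 2 * |θ| ^ 3 := by ring
      _ ≤ 1 * (θ ^ 2 / n ^ 2 * (S n a : ℝ) ^ 2) + 2 * |θ| ^ 3 := by gcongr
      _ = _ := by rw [one_mul]
  have hsq_int : Integrable (fun a => θ ^ 2 / n ^ 2 * (S n a : ℝ) ^ 2) μ :=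
    integrable_comp_of_abs_le (hSmeas n) (hSabs n) fun j => θ ^ 2 / n ^ 2 * (j : ℝ) ^ 2
  refine (norm_integral_le_of_norm_le (hsq_int.add (integrable_const _))
    (.of_forall hbound)).trans ?_
  simp only [Pi.add_apply]
  rw [integral_add hsq_int (integrable_const _), integral_const_mul]
  have hM := reinforced_walk_integral_sq_le hSmeas hVmeas hVval hSsucc hSabs hstep hc hn
  have hmul : θ ^ 2 / n ^ 2 * ∫ a, (S n a : ℝ) ^ 2 ∂μ
      ≤ θ ^ 2 / n ^ 2 * ((1 - 2 * max c 0)⁻¹ * n) := by gcongr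
  have hsimp : θ ^ 2 / n ^ 2 * ((1 - 2 * max c 0)⁻¹ * n) = θ ^ 2 / n * (1 - 2 * max c 0)⁻¹ := by
    field_simp
  simpa [hsimp] using hmul

/-- The Gaussian characteristic functions with variance `n / (1 - 2 c)` obey the same one-step
recursion as the walk, up to a small error. -/
lemma abs_gaussian_step_le (hc1 : -1 ≤ c) (hc : c < 1 / 2) {n : ℕ} (hn : 1 ≤ n) (θ : ℝ) :
    |Real.exp (-θ ^ 2 / 2) * Real.exp (-(n * (θ * (1 + c / n)) ^ 2 / (1 - 2 * c) / 2))
      - Real.exp (-((n + 1 : ℕ) * θ ^ 2 / (1 - 2 * c) / 2))|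
      ≤ θ ^ 2 / n * (1 - 2 * c)⁻¹ := by
  have hn0 : (0 : ℝ) < n := by exact_mod_cast hn
  have hd : 0 < 1 - 2 * c := by linarith
  have hc2 : c ^ 2 ≤ 1 := (sq_le_one_iff_abs_le_one c).2 (abs_le.2 ⟨hc1, by linarith⟩)
  set u := ((n + 1 : ℕ) : ℝ) * θ ^ 2 / (1 - 2 * c) / 2 with hu
  set δ := c ^ 2 * (θ ^ 2 / n * (1 - 2 * c)⁻¹ / 2) with hδ
  have hδ0 : 0 ≤ δ := by positivity
  have hu0 : 0 ≤ u := by positivity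
  have hsum : -θ ^ 2 / 2 + -(n * (θ * (1 + c / n)) ^ 2 / (1 - 2 * c) / 2) = -u + -δ := by
    rw [hu, hδ]; push_cast; field_simp; ring
  rw [← Real.exp_add, hsum, Real.exp_add]
  have h1 : Real.exp (-u) ≤ 1 := Real.exp_le_one_iff.2 (by linarith)
  have h2 : Real.exp (-δ) ≤ 1 := Real.exp_le_one_iff.2 (by linarith)
  have h3 := Real.add_one_le_exp (-δ)
  have h4 := Real.exp_pos (-u)
  have hδle : δ ≤ θ ^ 2 / n * (1 - 2 * c)⁻¹ := by
    have : 0 ≤ θ ^ 2 / n * (1 - 2 * c)⁻¹ := by positivity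
    rw [hδ]; nlinarith
  rw [abs_le]
  constructor <;> nlinarith

/-- The characteristic function of the walk is asymptotically Gaussian on the diffusive scale. -/
lemma reinforced_walk_tendsto_charFun (hSmeas : ∀ n, Measurable (S n))
    (hVmeas : ∀ n, Measurable (V n))
    (hVval : ∀ n a, 1 ≤ n → V n a = 1 ∨ V n a = -1)
    (hSsucc : ∀ n a, S (n + 1) a = S n a + V (n + 1) a) (hSabs : ∀ n a, |S n a| ≤ n)
    (hstep : ∀ n : ℕ, 1 ≤ n → ∀ f : ℤ → ℂ,
      ∫ a, (V (n + 1) a : ℂ) * f (S n a) ∂μ = ∫ a, ((c / n * S n a : ℝ) : ℂ) * f (S n a) ∂μ)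
    (hc1 : -1 ≤ c) (hc : c < 1 / 2) (t : ℝ) :
    Tendsto (fun n : ℕ => ∫ a, Complex.exp ((t / Real.sqrt n : ℝ) * S n a * Complex.I) ∂μ)
      atTop (𝓝 (Real.exp (-(t ^ 2 / (1 - 2 * c) / 2)))) := by
  have hd : 0 < 1 - 2 * c := by linarith
  have hd' : 0 < 1 - 2 * max c 0 := by
    have : max c 0 < 1 / 2 := max_lt hc (by norm_num)
    linarith
  set φ : ℕ → ℝ → ℂ := fun n θ => ∫ a, Complex.exp (θ * S n a * Complex.I) ∂μ with hφ
  set G : ℕ → ℝ → ℝ := fun n θ => Real.exp (-(n * θ ^ 2 / (1 - 2 * c) / 2)) with hG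
  have hG1 : ∀ n θ, G n θ ≤ 1 := fun n θ =>
    Real.exp_le_one_iff.2 (neg_nonpos.2 (by positivity))
  have hunit : ∀ n a (θ : ℝ), ‖Complex.exp (θ * S n a * Complex.I)‖ = 1 := fun n a θ => by
    exact_mod_cast Complex.norm_exp_ofReal_mul_I (θ * S n a)
  have hφ1 : ∀ n θ, ‖φ n θ‖ ≤ 1 := fun n θ => by
    simpa using norm_integral_le_of_norm_le_const (μ := μ)
      (.of_forall fun a => (hunit n a θ).le)
  have hlim : Tendsto (fun n : ℕ => ‖φ n (t / Real.sqrt n) - G n (t / Real.sqrt n)‖) atTop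
      (𝓝 0) := by
    refine tendsto_div_sqrt_of_recursive_bound (D := fun n θ => ‖φ n θ - G n θ‖)
      (C := (1 - 2 * max c 0)⁻¹ + (1 - 2 * c)⁻¹ + 2) hc1 hc (by positivity)
      (fun n θ => norm_nonneg _) (fun n θ => ?_) (fun n => ?_) (fun n hn θ hθ => ?_) t
    · refine (norm_sub_le _ _).trans ?_
      have h1 := hφ1 n θ
      have h2 : ‖(G n θ : ℂ)‖ ≤ 1 := by
        rw [Complex.norm_real, Real.norm_of_nonneg (Real.exp_nonneg _)]
        exact hG1 n θ
      linarith
    · refine ⟨n + n * (1 - 2 * c)⁻¹, fun θ hθ => ?_⟩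
      have hφ_lin : ‖φ n θ - 1‖ ≤ n * |θ| := by
        have hsub : φ n θ - 1 = ∫ a, (Complex.exp (θ * S n a * Complex.I) - 1) ∂μ := by
          rw [integral_sub (integrable_comp_of_abs_le (hSmeas n) (hSabs n)
            fun j => Complex.exp (θ * j * Complex.I)) (integrable_const 1)]
          simp [hφ]
        rw [hsub]
        refine (norm_integral_le_of_norm_le_const (C := n * |θ|) (.of_forall fun a => ?_)).trans
          (by simp)
        have h := Real.norm_exp_I_mul_ofReal_sub_one_le (x := θ * S n a)
        have hSa : |(S n a : ℝ)| ≤ n := by exact_mod_cast hSabs n a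
        rw [mul_comm, Real.norm_eq_abs, abs_mul, Complex.ofReal_mul, Complex.ofReal_intCast] at h
        rw [mul_comm (n : ℝ)]
        exact h.trans (by gcongr)
      have hG_lin : ‖(1 : ℂ) - G n θ‖ ≤ n * (1 - 2 * c)⁻¹ * |θ| := by
        have h1 := hG1 n θ
        have h2 := Real.add_one_le_exp (-(n * θ ^ 2 / (1 - 2 * c) / 2))
        have h3 : n * θ ^ 2 / (1 - 2 * c) / 2 ≤ n * (1 - 2 * c)⁻¹ * |θ| := by
          have hsq : θ ^ 2 / 2 ≤ |θ| := by rw [← sq_abs]; nlinarith [abs_nonneg θ]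
          calc n * θ ^ 2 / (1 - 2 * c) / 2 = n * (1 - 2 * c)⁻¹ * (θ ^ 2 / 2) := by ring
            _ ≤ _ := by gcongr
        rw [← Complex.ofReal_one, ← Complex.ofReal_sub, Complex.norm_real,
          Real.norm_of_nonneg (by linarith)]
        simp only [hG]
        linarith
      calc ‖φ n θ - G n θ‖ = ‖(φ n θ - 1) + (1 - G n θ)‖ := by ring_nf
        _ ≤ n * |θ| + n * (1 - 2 * c)⁻¹ * |θ| :=
          (norm_add_le _ _).trans (add_le_add hφ_lin hG_lin)
        _ = _ := by ring
    · have hstepφ :=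
        reinforced_walk_norm_charFun_step_le hSmeas hVmeas hVval hSsucc hSabs hstep hc1 hc hn hθ
      have hstepG := abs_gaussian_step_le hc1 hc hn θ
      set θ' := θ * (1 + c / n) with hθ'
      have hg1 : Real.exp (-θ ^ 2 / 2) ≤ 1 := Real.exp_le_one_iff.2 (by nlinarith [sq_nonneg θ])
      have hsplit : φ (n + 1) θ - G (n + 1) θ
          = (φ (n + 1) θ - Complex.exp (-θ ^ 2 / 2) * φ n θ')
            + ((Real.exp (-θ ^ 2 / 2) : ℝ) : ℂ) * (φ n θ' - G n θ')
            + ((Real.exp (-θ ^ 2 / 2) * G n θ' - G (n + 1) θ : ℝ) : ℂ) := by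
        push_cast; ring
      have hmid : ‖((Real.exp (-θ ^ 2 / 2) : ℝ) : ℂ) * (φ n θ' - G n θ')‖
          ≤ ‖φ n θ' - G n θ'‖ := by
        rw [norm_mul, Complex.norm_real, Real.norm_of_nonneg (Real.exp_nonneg _)]
        exact mul_le_of_le_one_left (norm_nonneg _) hg1
      have hlast : ‖((Real.exp (-θ ^ 2 / 2) * G n θ' - G (n + 1) θ : ℝ) : ℂ)‖
          ≤ θ ^ 2 / n * (1 - 2 * c)⁻¹ := by
        rw [Complex.norm_real]; exact hstepG
      have hadd := norm_add₃_le (a := φ (n + 1) θ - Complex.exp (-θ ^ 2 / 2) * φ n θ')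
        (b := ((Real.exp (-θ ^ 2 / 2) : ℝ) : ℂ) * (φ n θ' - G n θ'))
        (c := ((Real.exp (-θ ^ 2 / 2) * G n θ' - G (n + 1) θ : ℝ) : ℂ))
      rw [← hsplit] at hadd
      have h1 : 0 ≤ θ ^ 2 / n := by positivity
      have h2 : 0 ≤ |θ| ^ 3 := by positivity
      have h3 : 0 ≤ (1 - 2 * max c 0)⁻¹ * |θ| ^ 3 := by positivity
      have h4 : 0 ≤ (1 - 2 * c)⁻¹ * |θ| ^ 3 := by positivity
      change ‖φ (n + 1) θ - G (n + 1) θ‖ ≤ ‖φ n θ' - G n θ'‖ + _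
      change ‖φ (n + 1) θ - Complex.exp (-θ ^ 2 / 2) * φ n θ'‖ ≤ _ at hstepφ
      linarith
  rw [tendsto_iff_norm_sub_tendsto_zero]
  refine hlim.congr' ?_
  filter_upwards [eventually_ge_atTop 1] with n hn
  have hn0 : (0 : ℝ) < n := by exact_mod_cast hn
  have hGn : G n (t / Real.sqrt n) = Real.exp (-(t ^ 2 / (1 - 2 * c) / 2)) := by
    simp only [hG]
    rw [div_pow, Real.sq_sqrt hn0.le, mul_div_cancel₀ _ hn0.ne']
  rw [hGn]

end LinearlyReinforced

/-- Random variables whose characteristic functions converge to the one of the standard normal law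
have distribution functions converging to the standard normal one. -/
lemma tendsto_measure_le_of_tendsto_charFun {Ω : Type*} [MeasurableSpace Ω] {μ : Measure Ω}
    [IsProbabilityMeasure μ] {Z : ℕ → Ω → ℝ} (hZ : ∀ n, Measurable (Z n))
    (h : ∀ t : ℝ, Tendsto (fun n => ∫ a, Complex.exp (t * Z n a * Complex.I) ∂μ) atTop
      (𝓝 (Real.exp (-(t ^ 2 / 2))))) (x : ℝ) :
    Tendsto (fun n => (μ {a | Z n a ≤ x}).toReal) atTop
      (𝓝 ((Real.sqrt (2 * Real.pi))⁻¹ * ∫ t in Set.Iic x, Real.exp (-t ^ 2 / 2))) := by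
  let P : ℕ → ProbabilityMeasure ℝ := fun n =>
    ⟨μ.map (Z n), Measure.isProbabilityMeasure_map (hZ n).aemeasurable⟩
  let γ : ProbabilityMeasure ℝ := ⟨gaussianReal 0 1, inferInstance⟩
  have hP : Tendsto P atTop (𝓝 γ) := by
    refine ProbabilityMeasure.tendsto_of_tendsto_charFun fun t => ?_
    have hP_charFun : ∀ n, charFun (P n : Measure ℝ) t
        = ∫ a, Complex.exp (t * Z n a * Complex.I) ∂μ := fun n => by
      rw [charFun_apply_real]
      exact integral_map (hZ n).aemeasurable (by fun_prop)
    have hγ_charFun : charFun (γ : Measure ℝ) t = Real.exp (-(t ^ 2 / 2)) := by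
      refine (charFun_gaussianReal t).trans ?_
      push_cast
      congr 1
      simp
    simp_rw [hP_charFun, hγ_charFun]
    exact h t
  have : NullSingletonClass (γ : Measure ℝ) := nullSingletonClass_gaussianReal one_ne_zero
  have hIic := ProbabilityMeasure.tendsto_measure_of_null_frontier_of_tendsto' hP
    (E := Set.Iic x) (by rw [frontier_Iic]; exact measure_singleton x)
  have hγ : ((γ : Measure ℝ) (Set.Iic x)).toReal
      = (Real.sqrt (2 * Real.pi))⁻¹ * ∫ t in Set.Iic x, Real.exp (-t ^ 2 / 2) := by
    change (gaussianReal 0 1 (Set.Iic x)).toReal = _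
    rw [gaussianReal_apply_eq_integral 0 one_ne_zero, ENNReal.toReal_ofReal
      (integral_nonneg fun _ => gaussianPDFReal_nonneg _ _ _), ← integral_const_mul]
    simp [gaussianPDFReal]
  rw [← hγ]
  refine ((ENNReal.tendsto_toReal (measure_ne_top _ _)).comp hIic).congr fun n => ?_
  exact congrArg ENNReal.toReal (Measure.map_apply (hZ n) measurableSet_Iic)

/-- Lemma 3.7: asymptotic normality of the step-reinforced random walk in the diffusive
regime: for `0 ≤ p < 3/4` and every `x ∈ ℝ`,
`P(S^{(p)}_n/√n ≤ (3 − 4p)^{−1/2} x) → (2π)^{−1/2} ∫_{−∞}^x e^{−t²/2} dt`. -/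
theorem reinforced_walk_CLT
    {Ω : Type*} [MeasurableSpace Ω] (μ : Measure Ω) [IsProbabilityMeasure μ]
    -- step-reinforced walk with memory parameter p
    (p : ℝ) (hp0 : 0 ≤ p) (hp34 : p < 3 / 4)
    (V : ℕ → Ω → ℤ) (hVmeas : ∀ n, Measurable (V n))
    (hVval : ∀ n a, 1 ≤ n → V n a = 1 ∨ V n a = -1)
    (hV1 : μ {a | V 1 a = 1} = 1 / 2)
    (S : ℕ → Ω → ℤ) (hS : ∀ n a, S n a = ∑ k ∈ Finset.range n, V (k + 1) a)
    (hcond : ∀ n : ℕ, 1 ≤ n →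
      μ[({a | V (n + 1) a = 1}).indicator (fun _ => (1 : ℝ)) |
          ⨆ k ∈ Set.Icc 1 n, MeasurableSpace.comap (V k) inferInstance]
        =ᵐ[μ] fun a => 1 / 2 + (2 * p - 1) * (S n a : ℝ) / (2 * n)) :
    ∀ x : ℝ,
      Tendsto
        (fun n : ℕ =>
          (μ {a | (S n a : ℝ) / Real.sqrt n ≤ (Real.sqrt (3 - 4 * p))⁻¹ * x}).toReal)
        atTop
        (𝓝 ((Real.sqrt (2 * Real.pi))⁻¹ * ∫ t in Set.Iic x, Real.exp (-t ^ 2 / 2))) := by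
  intro x
  have hSeq : ∀ n, S n = fun a => ∑ k ∈ Finset.range n, V (k + 1) a := fun n => funext (hS n)
  have hSmeas : ∀ n, Measurable (S n) := fun n => by
    rw [hSeq]; exact Finset.measurable_sum _ fun k _ => hVmeas (k + 1)
  have hSsucc : ∀ n a, S (n + 1) a = S n a + V (n + 1) a := fun n a => by
    rw [hS, hS, Finset.sum_range_succ]
  have hSabs : ∀ n a, |S n a| ≤ n := fun n a => by
    rw [hS]
    refine (Finset.abs_sum_le_sum_abs _ _).trans_eq ?_
    have hone : ∀ k, |V (k + 1) a| = 1 := fun k => by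
      rcases hVval (k + 1) a (by omega) with h | h <;> simp [h]
    simp [hone]
  have hstep : ∀ n : ℕ, 1 ≤ n → ∀ f : ℤ → ℂ, ∫ a, (V (n + 1) a : ℂ) * f (S n a) ∂μ
      = ∫ a, (((2 * p - 1) / n * S n a : ℝ) : ℂ) * f (S n a) ∂μ := by
    intro n hn f
    have hSm : Measurable[⨆ k ∈ Set.Icc 1 n, MeasurableSpace.comap (V k) inferInstance]
        (S n) := by
      rw [hSeq]
      refine Finset.measurable_sum _ fun k hk => ?_
      rw [Finset.mem_range] at hk
      exact measurable_iff_comap_le.2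
        (le_iSup₂_of_le (k + 1) ⟨by omega, by omega⟩ le_rfl)
    refine integral_step_mul_comp (iSup₂_le fun k _ => (hVmeas k).comap_le) hSm (hSabs n) (hVmeas (n + 1))
      (fun a => hVval (n + 1) a (by omega)) ((hcond n hn).trans (.of_forall fun a => ?_)) f
    ring
  have hd : 0 < 3 - 4 * p := by linarith
  have hsd : 0 < Real.sqrt (3 - 4 * p) := Real.sqrt_pos.2 hd
  have hlim := tendsto_measure_le_of_tendsto_charFun (μ := μ)
    (Z := fun n a => Real.sqrt (3 - 4 * p) * (S n a / Real.sqrt n))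
    (fun n => by have := hSmeas n; fun_prop) (fun t => ?_) x
  · refine hlim.congr fun n => ?_
    congr with a
    rw [inv_mul_eq_div, le_div_iff₀' hsd]
  · have h := reinforced_walk_tendsto_charFun hSmeas hVmeas hVval hSsucc hSabs hstep (by linarith)
      (by linarith) (t * Real.sqrt (3 - 4 * p))
    have hvar : (t * Real.sqrt (3 - 4 * p)) ^ 2 / (1 - 2 * (2 * p - 1)) = t ^ 2 := by
      rw [mul_pow, Real.sq_sqrt hd.le, show 1 - 2 * (2 * p - 1) = 3 - 4 * p by ring,
        mul_div_cancel_right₀ _ hd.ne']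
    rw [hvar] at h
    refine h.congr fun n => ?_
    congr with a
    push_cast
    ring_nf
end
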